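/- arXiv:1806.08306 — 8 statements merged into one kernel-verified Lean document; each statement's English description precedes it below -/
import Mathlib

section
/- Let l ≥ 1 and let Λ_1, …, Λ_l be positive integers; set S_j := Λ_1 + ⋯ + Λ_j for 1 ≤ j ≤ l. Then the integer identity (Σ_{s=1}^l Λ_s) · ∏_{j=1}^l (S_j − 1) = Σ_{s=1}^l (Λ_s − 1) · (∏_{j=1}^{s−1} (S_j − 1)) · (∏_{j=s}^l S_j) holds. -/
/-- Key induction identity with cleared denominators: for positive integers
`Λ_1, …, Λ_l` with partial sums `S_j = Λ_1 + ⋯ + Λ_j`,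
`(Σ_s Λ_s) · ∏_{j=1}^l (S_j − 1)
  = Σ_{s=1}^l (Λ_s − 1) · (∏_{j<s} (S_j − 1)) · (∏_{j≥s} S_j)`. -/
theorem key_sum_induct (l : ℕ) (hl : 1 ≤ l) (Λ : Fin l → ℕ) (hΛ : ∀ i, 1 ≤ Λ i) :
    (∑ s : Fin l, Λ s) *
        ∏ j : Fin l, ((∑ r ∈ Finset.univ.filter (· ≤ j), Λ r) - 1)
      = ∑ s : Fin l,
          (Λ s - 1) *
            (∏ j ∈ Finset.univ.filter (· < s),
                ((∑ r ∈ Finset.univ.filter (· ≤ j), Λ r) - 1)) *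
            (∏ j ∈ Finset.univ.filter (fun j => s ≤ j),
                (∑ r ∈ Finset.univ.filter (· ≤ j), Λ r)) := by
  clear hl
  induction l with
  | zero => simp
  | succ n ih =>
    have ih := ih (fun i => Λ i.castSucc) (fun i => hΛ _)
    have h_last := hΛ (Fin.last n)
    simp only [Finset.sum_filter, Finset.prod_filter] at ih ⊢
    simp only [Fin.sum_univ_castSucc, Fin.prod_univ_castSucc, Fin.castSucc_le_castSucc_iff,
      Fin.castSucc_lt_castSucc_iff, Fin.le_last, Fin.castSucc_lt_last, Fin.last_le_iff,
      Fin.castSucc_ne_last, Fin.not_lt.mpr (Fin.le_last _), if_true, if_false,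
      add_zero, mul_one, one_mul, Finset.prod_const_one]
    simp only [← mul_assoc, ← Finset.sum_mul]
    rw [← ih, Nat.add_sub_assoc h_last]
    ring
end

section
/- For every composition λ = (λ_1, …, λ_l) of k, the number of set partitions of [k] whose shape is λ equals k! / ∏_{j=1}^{l} [ (λ_j − 1)! · |λ|_j ], where |λ|_j = λ_1 + ⋯ + λ_j. -/
/-- `P` is a set partition of `[k] = {1,…,k}`: its blocks are nonempty,
pairwise disjoint, and their union is `{1,…,k}`. -/
def IsSetPartition (k : ℕ) (P : Finset (Finset ℕ)) : Prop :=
  (∀ b ∈ P, b.Nonempty) ∧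
    (∀ b ∈ P, ∀ c ∈ P, b ≠ c → Disjoint b c) ∧
    P.sup id = Finset.Icc 1 k

/-- The shape of a set partition: the list of block sizes, blocks being listed
increasingly according to their largest element (normal ordering). -/
def shape (P : Finset (Finset ℕ)) : List ℕ :=
  (List.range ((P.sup fun b => b.sup id) + 1)).filterMap fun m =>
    let c := P.sup fun b => if m ∈ b ∧ ∀ x ∈ b, x ≤ m then b.card else 0
    if c = 0 then none else some c

/-- `Π⁻`: decrease every element of every block by `1`, delete the resulting
`0` from its block, and delete the block if it becomes empty. -/
def pminus (P : Finset (Finset ℕ)) : Finset (Finset ℕ) :=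
  (P.image fun b => (b.image fun x => x - 1).erase 0).filter fun b => b.Nonempty

/-- One-step relation on compositions (as lists of positive integers):
`λ → Λ` iff `Λ` is obtained from `λ` by increasing exactly one entry by `1`,
or by prepending a new first entry equal to `1`. -/
def Step (lam Lam : List ℕ) : Prop :=
  Lam = 1 :: lam ∨ ∃ j : Fin lam.length, Lam = lam.set j (lam.get j + 1)


/-- `P` partitions the finite set `S` into nonempty blocks. -/
def IsPartitionOf (S : Finset ℕ) (P : Finset (Finset ℕ)) : Prop :=
  (∀ b ∈ P, b.Nonempty) ∧ (∀ b ∈ P, ∀ c ∈ P, b ≠ c → Disjoint b c) ∧ P.sup id = S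

/-- The size of the block of `P` with largest element `m`, if there is one. -/
def blockSizeAt (P : Finset (Finset ℕ)) (m : ℕ) : Option ℕ :=
  let c := P.sup fun b => if m ∈ b ∧ ∀ x ∈ b, x ≤ m then b.card else 0
  if c = 0 then none else some c

open Classical in
/-- The partitions of `S` of shape `lam`. -/
noncomputable def partitionsOfShape (S : Finset ℕ) (lam : List ℕ) : Finset (Finset (Finset ℕ)) :=
  S.powerset.powerset.filter fun P => IsPartitionOf S P ∧ shape P = lam

theorem IsPartitionOf.subset {S b : Finset ℕ} {P : Finset (Finset ℕ)} (h : IsPartitionOf S P)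
    (hb : b ∈ P) : b ⊆ S := by
  rw [← h.2.2]
  exact Finset.le_sup (f := id) hb

theorem mem_partitionsOfShape {S : Finset ℕ} {lam : List ℕ} {P : Finset (Finset ℕ)} :
    P ∈ partitionsOfShape S lam ↔ IsPartitionOf S P ∧ shape P = lam := by
  classical
  simp only [partitionsOfShape, Finset.mem_filter, and_iff_right_iff_imp]
  intro h
  rw [Finset.mem_powerset]
  intro b hb
  exact Finset.mem_powerset.2 (h.1.subset hb)

theorem filterMap_range_eq_of_le {f : ℕ → Option ℕ} {n N : ℕ} (hn : n ≤ N)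
    (hf : ∀ i, n ≤ i → f i = none) :
    (List.range N).filterMap f = (List.range n).filterMap f := by
  induction N, hn using Nat.le_induction with
  | base => rfl
  | succ N hN ih => simp [List.range_succ, ih, hf N hN]

theorem blockSizeAt_eq_none {P : Finset (Finset ℕ)} {m : ℕ} (h : ∀ b ∈ P, m ∉ b) :
    blockSizeAt P m = none := by
  have : (P.sup fun b => if m ∈ b ∧ ∀ x ∈ b, x ≤ m then b.card else 0) = 0 := by
    rw [← Nat.bot_eq_zero, Finset.sup_eq_bot_iff]
    intro b hb
    simp [h b hb]
  simp only [blockSizeAt, this, if_true]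

theorem shape_eq_filterMap_range {P : Finset (Finset ℕ)} {n : ℕ} (h : ∀ b ∈ P, ∀ x ∈ b, x < n) :
    shape P = (List.range n).filterMap (blockSizeAt P) := by
  change (List.range ((P.sup fun b => b.sup id) + 1)).filterMap (blockSizeAt P) = _
  have hM : ∀ b ∈ P, ∀ x ∈ b, x < (P.sup fun b => b.sup id) + 1 := by
    intro b hb x hx
    have h1 : x ≤ b.sup id := Finset.le_sup (f := id) hx
    have h2 : b.sup id ≤ P.sup fun b => b.sup id := Finset.le_sup (f := fun b => b.sup id) hb
    omega
  rw [← filterMap_range_eq_of_le (le_max_left _ n), ← filterMap_range_eq_of_le (le_max_right _ n)]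
  · exact fun i hi => blockSizeAt_eq_none fun b hb hib => (h b hb i hib).not_ge hi
  · exact fun i hi => blockSizeAt_eq_none fun b hb hib => (hM b hb i hib).not_ge hi

theorem shape_insert {P : Finset (Finset ℕ)} {b : Finset ℕ} {m : ℕ} (hm : m ∈ b)
    (hb : ∀ x ∈ b, x ≤ m) (hP : ∀ c ∈ P, ∀ x ∈ c, x < m) :
    shape (insert b P) = shape P ++ [b.card] := by
  rw [shape_eq_filterMap_range (n := m + 1), shape_eq_filterMap_range hP, List.range_succ,
    List.filterMap_append]
  · congr 1
    · refine List.filterMap_congr fun i hi => ?_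
      have hi := List.mem_range.1 hi
      have : ¬ (i ∈ b ∧ ∀ x ∈ b, x ≤ i) := fun h => (h.2 m hm).not_gt hi
      simp [blockSizeAt, Finset.sup_insert, if_neg this]
    · have h0 : (P.sup fun b => if m ∈ b ∧ ∀ x ∈ b, x ≤ m then b.card else 0) = 0 := by
        rw [← Nat.bot_eq_zero, Finset.sup_eq_bot_iff]
        intro c hc
        exact if_neg fun h => (hP c hc m h.1).false
      have hc : b.card ≠ 0 := (Finset.card_pos.2 ⟨m, hm⟩).ne'
      have : blockSizeAt (insert b P) m = some b.card := by
        simp only [blockSizeAt, Finset.sup_insert, h0, if_pos (And.intro hm hb)]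
        simp [Finset.nonempty_iff_ne_empty.1 ⟨m, hm⟩]
      simp [this]
  · intro c hc x hx
    rcases Finset.mem_insert.1 hc with rfl | hc
    · exact Nat.lt_succ_of_le (hb x hx)
    · exact (hP c hc x hx).trans (Nat.lt_succ_self m)

theorem IsPartitionOf.insert {S b : Finset ℕ} {P : Finset (Finset ℕ)} (hb : b.Nonempty)
    (hbS : b ⊆ S) (h : IsPartitionOf (S \ b) P) : IsPartitionOf S (insert b P) := by
  have hd : ∀ c ∈ P, Disjoint c b := fun c hc =>
    Finset.disjoint_of_subset_left (h.subset hc) Finset.sdiff_disjoint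
  refine ⟨fun c hc => ?_, fun c hc d hd' hcd => ?_, ?_⟩
  · rcases Finset.mem_insert.1 hc with rfl | hc
    exacts [hb, h.1 c hc]
  · rcases Finset.mem_insert.1 hc with rfl | hcP <;> rcases Finset.mem_insert.1 hd' with rfl | hdP
    exacts [absurd rfl hcd, (hd d hdP).symm, hd c hcP, h.2.1 c hcP d hdP hcd]
  · rw [Finset.sup_insert, h.2.2]
    exact Finset.union_sdiff_of_subset hbS

theorem IsPartitionOf.erase {S b : Finset ℕ} {P : Finset (Finset ℕ)} (hb : b ∈ P)
    (h : IsPartitionOf S P) : IsPartitionOf (S \ b) (P.erase b) := by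
  refine ⟨fun c hc => h.1 c (Finset.mem_of_mem_erase hc), fun c hc d hd =>
    h.2.1 c (Finset.mem_of_mem_erase hc) d (Finset.mem_of_mem_erase hd), ?_⟩
  have hS : S = b ∪ (P.erase b).sup id := by
    rw [← h.2.2]
    conv_lhs => rw [← Finset.insert_erase hb, Finset.sup_insert]
    rfl
  have hd : Disjoint ((P.erase b).sup id) b := by
    rw [Finset.disjoint_sup_left]
    exact fun c hc => h.2.1 c (Finset.mem_of_mem_erase hc) b hb (Finset.ne_of_mem_erase hc)
  rw [hS, Finset.union_sdiff_cancel_left hd.symm]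

theorem card_partitionsOfShape_append {S : Finset ℕ} {m a N : ℕ} {lam : List ℕ} (hm : m ∈ S)
    (hmax : ∀ x ∈ S, x ≤ m) (ha : 0 < a)
    (hN : ∀ b ⊆ S, b.card = a → (partitionsOfShape (S \ b) lam).card = N) :
    (partitionsOfShape S (lam ++ [a])).card = (S.card - 1).choose (a - 1) * N := by
  have hlt : ∀ {c P}, m ∈ c → IsPartitionOf (S \ c) P → ∀ d ∈ P, ∀ x ∈ d, x < m := by
    intro c P hc hP d hd x hx
    have hx := hP.subset hd hx
    rw [Finset.mem_sdiff] at hx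
    exact lt_of_le_of_ne (hmax x hx.1) fun h => hx.2 (h ▸ hc)
  set B := ((S.erase m).powersetCard (a - 1)).image (insert m) with hB
  have hBcard : B.card = (S.card - 1).choose (a - 1) := by
    rw [hB, Finset.card_image_of_injOn, Finset.card_powersetCard, Finset.card_erase_of_mem hm]
    intro c hc d hd hcd
    have hc' : m ∉ c := fun h => Finset.notMem_erase m S ((Finset.mem_powersetCard.1 hc).1 h)
    have hd' : m ∉ d := fun h => Finset.notMem_erase m S ((Finset.mem_powersetCard.1 hd).1 h)
    rw [← Finset.erase_insert hc', ← Finset.erase_insert hd', hcd]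
  have hmemB : ∀ b, b ∈ B ↔ b ⊆ S ∧ m ∈ b ∧ b.card = a := by
    intro b
    simp only [hB, Finset.mem_image, Finset.mem_powersetCard]
    constructor
    · rintro ⟨c, ⟨hc, hca⟩, rfl⟩
      have hmc : m ∉ c := fun h => Finset.notMem_erase m S (hc h)
      refine ⟨Finset.insert_subset hm (hc.trans (Finset.erase_subset _ _)),
        Finset.mem_insert_self _ _, ?_⟩
      rw [Finset.card_insert_of_notMem hmc]
      omega
    · rintro ⟨hbS, hmb, hba⟩
      exact ⟨b.erase m, ⟨Finset.erase_subset_erase _ hbS, by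
        rw [Finset.card_erase_of_mem hmb, hba]⟩, Finset.insert_erase hmb⟩
  have hcard : (B.sigma fun b => partitionsOfShape (S \ b) lam).card =
      (S.card - 1).choose (a - 1) * N := by
    rw [Finset.card_sigma, Finset.sum_congr rfl fun b hb =>
      hN b ((hmemB b).1 hb).1 ((hmemB b).1 hb).2.2, Finset.sum_const, smul_eq_mul, hBcard]
  rw [← hcard]
  symm
  refine Finset.card_bij (fun p _ => insert p.1 p.2) ?_ ?_ ?_
  · rintro ⟨b, P⟩ hp
    obtain ⟨hb, hP⟩ := Finset.mem_sigma.1 hp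
    obtain ⟨hbS, hmb, hba⟩ := (hmemB b).1 hb
    have hP' := mem_partitionsOfShape.1 hP
    refine mem_partitionsOfShape.2 ⟨hP'.1.insert ⟨m, hmb⟩ hbS, ?_⟩
    rw [shape_insert hmb (fun x hx => hmax x (hbS hx)) (hlt hmb hP'.1), hP'.2, hba]
  · rintro ⟨b, P⟩ hp ⟨c, Q⟩ hq heq
    obtain ⟨hb, hP⟩ := Finset.mem_sigma.1 hp
    obtain ⟨hc, hQ⟩ := Finset.mem_sigma.1 hq
    replace hP := (mem_partitionsOfShape.1 hP).1
    replace hQ := (mem_partitionsOfShape.1 hQ).1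
    have hmb := ((hmemB b).1 hb).2.1
    have hmc := ((hmemB c).1 hc).2.1
    have hbP : b ∉ P := fun h => (hlt hmb hP b h m hmb).false
    have hcQ : c ∉ Q := fun h => (hlt hmc hQ c h m hmc).false
    simp only at heq
    have hbc : b = c := by
      have : b ∈ insert c Q := heq ▸ Finset.mem_insert_self b P
      rcases Finset.mem_insert.1 this with h | h
      · exact h
      · exact ((hlt hmc hQ b h m hmb).false).elim
    subst hbc
    have : P = Q := by rw [← Finset.erase_insert hbP, ← Finset.erase_insert hcQ, heq]
    rw [this]
  · intro P hP
    obtain ⟨hP, hshape⟩ := mem_partitionsOfShape.1 hP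
    obtain ⟨b, hb, hmb⟩ : ∃ b ∈ P, m ∈ b := by
      have := hP.2.2.symm ▸ hm
      simpa [Finset.mem_sup] using this
    have hbS := hP.subset hb
    have hE := hP.erase hb
    have hsh : shape P = shape (P.erase b) ++ [b.card] := by
      conv_lhs => rw [← Finset.insert_erase hb]
      exact shape_insert hmb (fun x hx => hmax x (hbS hx)) (hlt hmb hE)
    have h2 := List.append_inj' (hsh.symm.trans hshape) rfl
    refine ⟨⟨b, P.erase b⟩, Finset.mem_sigma.2 ⟨(hmemB b).2 ⟨hbS, hmb, by simpa using h2.2⟩,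
      mem_partitionsOfShape.2 ⟨hE, h2.1⟩⟩, Finset.insert_erase hb⟩

theorem partitionsOfShape_empty_nil : partitionsOfShape ∅ [] = {∅} := by
  ext P
  rw [mem_partitionsOfShape, Finset.mem_singleton]
  constructor
  · rintro ⟨h, -⟩
    refine Finset.eq_empty_of_forall_notMem fun b hb => ?_
    exact (h.1 b hb).ne_empty (Finset.subset_empty.1 (h.subset hb))
  · rintro rfl
    exact ⟨⟨by simp, by simp, by simp⟩, by simp [shape]⟩

/-- The denominator `∏ⱼ (λⱼ - 1)! · |λ|ⱼ`. -/
def shapeDenom (lam : List ℕ) : ℕ :=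
  ∏ j : Fin lam.length, ((lam.get j - 1).factorial * (lam.take (j.1 + 1)).sum)

theorem shapeDenom_append (lam : List ℕ) (a : ℕ) :
    shapeDenom (lam ++ [a]) = shapeDenom lam * ((a - 1).factorial * (lam.sum + a)) := by
  have key : ∀ l : List ℕ, shapeDenom l =
      ∏ i ∈ Finset.range l.length, ((l.getD i 0 - 1).factorial * (l.take (i + 1)).sum) := by
    intro l
    rw [Finset.prod_range, shapeDenom]
    exact Finset.prod_congr rfl fun j _ => by simp
  rw [key, key, List.length_append, List.length_singleton, Finset.prod_range_succ]
  congr 1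
  · refine Finset.prod_congr rfl fun i hi => ?_
    have hi := Finset.mem_range.1 hi
    rw [List.getD_append _ _ _ _ hi, List.take_append_of_le_length (by omega)]
  · simp [List.take_of_length_le]

theorem card_partitionsOfShape_mul_shapeDenom (lam : List ℕ) :
    ∀ S : Finset ℕ, (∀ x ∈ lam, 0 < x) → lam.sum = S.card →
      (partitionsOfShape S lam).card * shapeDenom lam = S.card.factorial := by
  induction lam using List.reverseRecOn with
  | nil =>
    intro S _ hS
    obtain rfl : S = ∅ := Finset.card_eq_zero.1 hS.symm
    simp [partitionsOfShape_empty_nil, shapeDenom]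
  | append_singleton lam a ih =>
    intro S hpos hS
    have ha : 0 < a := hpos a (by simp)
    have hpos' : ∀ x ∈ lam, 0 < x := fun x hx => hpos x (by simp [hx])
    rw [List.sum_append, List.sum_singleton] at hS
    have hne : S.Nonempty := Finset.card_pos.1 (by omega)
    have ih' : ∀ b ⊆ S, b.card = a →
        (partitionsOfShape (S \ b) lam).card * shapeDenom lam = lam.sum.factorial := by
      intro b hb hba
      have hc : (S \ b).card = lam.sum := by
        rw [Finset.card_sdiff_of_subset hb]
        omega
      rw [ih _ hpos' hc.symm, hc]
    have hD : 0 < shapeDenom lam := by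
      obtain ⟨b, hb, hba⟩ := Finset.exists_subset_card_eq (s := S) (n := a) (by omega)
      refine Nat.pos_of_ne_zero fun h => ?_
      have := ih' b hb hba
      rw [h, mul_zero] at this
      exact (Nat.factorial_pos _).ne this
    rw [card_partitionsOfShape_append (N := lam.sum.factorial / shapeDenom lam)
      (S.max'_mem hne) (fun x hx => S.le_max' x hx) ha
      fun b hb hba => Nat.eq_div_of_mul_eq_left hD.ne' (ih' b hb hba), shapeDenom_append, hS]
    have hdvd : lam.sum.factorial / shapeDenom lam * shapeDenom lam = lam.sum.factorial := by
      obtain ⟨b, hb, hba⟩ := Finset.exists_subset_card_eq (s := S) (n := a) (by omega)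
      exact Nat.div_mul_cancel (Dvd.intro_left _ (ih' b hb hba))
    have hchoose := Nat.choose_mul_factorial_mul_factorial (n := S.card - 1) (k := a - 1) (by omega)
    rw [show S.card - 1 - (a - 1) = lam.sum by omega] at hchoose
    rw [← Nat.mul_factorial_pred (n := S.card) (by omega), ← hchoose]
    calc _ = S.card * ((S.card - 1).choose (a - 1) * (a - 1).factorial *
          (lam.sum.factorial / shapeDenom lam * shapeDenom lam)) := by ring
      _ = _ := by rw [hdvd]

/-- For every composition `λ = (λ_1, …, λ_l)` of `k`, the number of set
partitions of `[k]` of shape `λ` is `k! / ∏_{j=1}^l [(λ_j − 1)! · |λ|_j]`,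
where `|λ|_j = λ_1 + ⋯ + λ_j`. -/
theorem card_partitions_of_shape (k : ℕ) (lam : List ℕ)
    (hpos : ∀ x ∈ lam, 0 < x) (hsum : lam.sum = k) :
    Nat.card {P : Finset (Finset ℕ) // IsSetPartition k P ∧ shape P = lam}
      = k.factorial /
          ∏ j : Fin lam.length, ((lam.get j - 1).factorial * (lam.take (j.1 + 1)).sum) := by
  have hcard : Nat.card {P : Finset (Finset ℕ) // IsSetPartition k P ∧ shape P = lam} =
      (partitionsOfShape (Finset.Icc 1 k) lam).card := by
    exact Nat.subtype_card _ fun _ => mem_partitionsOfShape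
  rw [hcard]
  have h := card_partitionsOfShape_mul_shapeDenom lam (Finset.Icc 1 k) hpos (by simpa using hsum)
  rw [Nat.card_Icc, Nat.add_sub_cancel] at h
  have hD : shapeDenom lam ≠ 0 := fun h0 => (Nat.factorial_pos k).ne (by rw [← h, h0, mul_zero])
  exact Nat.eq_div_of_mul_eq_left hD h
end

section
/- For every composition Λ of k, the number of chains of length k from the empty composition () to Λ (i.e. sequences () = λ^0 → λ^1 → ⋯ → λ^k = Λ of compositions with λ^i → λ^{i+1} for all 0 ≤ i < k) equals the number of set partitions of [k] whose shape is Λ. -/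
namespace SetPartitionShape

/-! ### Increasing one entry of a list -/

/-- The nonzero values of `g` along the list `l`. -/
def nonzeroValues (l : List ℕ) (g : ℕ → ℕ) : List ℕ :=
  l.filterMap fun m => if g m = 0 then none else some (g m)

/-- The list `L` is obtained from `l` by increasing one entry by `1`. -/
def IncrementsOne (l L : List ℕ) : Prop :=
  ∃ j : Fin l.length, L = l.set j (l.get j + 1)

lemma incrementsOne_nil (L : List ℕ) : ¬ IncrementsOne [] L := by
  rintro ⟨j, -⟩
  exact j.elim0

lemma incrementsOne_cons (x : ℕ) (l L : List ℕ) :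
    IncrementsOne (x :: l) L ↔
      L = (x + 1) :: l ∨ ∃ L', IncrementsOne l L' ∧ L = x :: L' := by
  constructor
  · rintro ⟨j, rfl⟩
    refine Fin.cases ?_ (fun i => ?_) j
    · left; simp
    · right; exact ⟨_, ⟨i, rfl⟩, by simp⟩
  · rintro (rfl | ⟨L', ⟨j, rfl⟩, rfl⟩)
    · exact ⟨⟨0, by simp⟩, by simp⟩
    · exact ⟨j.succ, by simp⟩

lemma nonzeroValues_congr {l : List ℕ} {g g' : ℕ → ℕ} (h : ∀ m ∈ l, g m = g' m) :
    nonzeroValues l g = nonzeroValues l g' :=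
  List.filterMap_congr fun m hm => by rw [h m hm]

lemma nonzeroValues_cons_of_eq {m : ℕ} {l : List ℕ} {g : ℕ → ℕ} (h : g m = 0) :
    nonzeroValues (m :: l) g = nonzeroValues l g := by
  simp [nonzeroValues, h]

lemma nonzeroValues_cons_of_ne {m : ℕ} {l : List ℕ} {g : ℕ → ℕ} (h : g m ≠ 0) :
    nonzeroValues (m :: l) g = g m :: nonzeroValues l g := by
  simp [nonzeroValues, h]

/-- `g` with its value at `t` increased by `1`. -/
def bump (g : ℕ → ℕ) (t m : ℕ) : ℕ := g m + if m = t then 1 else 0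

lemma nonzeroValues_bump_of_notMem {l : List ℕ} {g : ℕ → ℕ} {t : ℕ} (h : t ∉ l) :
    nonzeroValues l (bump g t) = nonzeroValues l g :=
  nonzeroValues_congr fun m hm => by
    have : m ≠ t := fun e => h (e ▸ hm)
    simp [bump, this]

lemma nonzeroValues_cons_bump_self {m : ℕ} {l : List ℕ} {g : ℕ → ℕ} (h : m ∉ l) :
    nonzeroValues (m :: l) (bump g m) = (g m + 1) :: nonzeroValues l g := by
  rw [nonzeroValues_cons_of_ne (by simp [bump]), nonzeroValues_bump_of_notMem h]
  simp [bump]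

lemma nonzeroValues_cons_bump_of_ne {m t : ℕ} {l : List ℕ} {g : ℕ → ℕ} (h : m ≠ t)
    (hg : g m ≠ 0) :
    nonzeroValues (m :: l) (bump g t) = g m :: nonzeroValues l (bump g t) := by
  rw [nonzeroValues_cons_of_ne (by simp [bump, hg])]
  simp [bump, h]

lemma nonzeroValues_cons_bump_of_ne_of_eq {m t : ℕ} {l : List ℕ} {g : ℕ → ℕ} (h : m ≠ t)
    (hg : g m = 0) :
    nonzeroValues (m :: l) (bump g t) = nonzeroValues l (bump g t) :=
  nonzeroValues_cons_of_eq (by simp [bump, hg, h])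

lemma incrementsOne_nonzeroValues_iff {l : List ℕ} (hl : l.Nodup) (g : ℕ → ℕ) (L : List ℕ) :
    IncrementsOne (nonzeroValues l g) L ↔
      ∃ t ∈ l, g t ≠ 0 ∧ L = nonzeroValues l (bump g t) := by
  induction l generalizing L with
  | nil => simpa [nonzeroValues] using incrementsOne_nil L
  | cons m l ih =>
    obtain ⟨hm, hl⟩ := List.nodup_cons.1 hl
    by_cases hg : g m = 0
    · rw [nonzeroValues_cons_of_eq hg, ih hl]
      constructor
      · rintro ⟨t, ht, hgt, rfl⟩
        exact ⟨t, List.mem_cons_of_mem _ ht, hgt,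
          (nonzeroValues_cons_bump_of_ne_of_eq (ne_of_mem_of_not_mem ht hm).symm hg).symm⟩
      · rintro ⟨t, ht, hgt, rfl⟩
        rcases List.mem_cons.1 ht with rfl | ht
        · exact absurd hg hgt
        · exact ⟨t, ht, hgt, nonzeroValues_cons_bump_of_ne_of_eq (ne_of_mem_of_not_mem ht hm).symm hg⟩
    · rw [nonzeroValues_cons_of_ne hg, incrementsOne_cons]
      constructor
      · rintro (rfl | ⟨L', hL', rfl⟩)
        · exact ⟨m, List.mem_cons_self, hg, (nonzeroValues_cons_bump_self hm).symm⟩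
        · obtain ⟨t, ht, hgt, rfl⟩ := (ih hl L').1 hL'
          exact ⟨t, List.mem_cons_of_mem _ ht, hgt,
            (nonzeroValues_cons_bump_of_ne (ne_of_mem_of_not_mem ht hm).symm hg).symm⟩
      · rintro ⟨t, ht, hgt, rfl⟩
        rcases List.mem_cons.1 ht with rfl | ht
        · exact Or.inl (nonzeroValues_cons_bump_self hm)
        · exact Or.inr ⟨_, (ih hl _).2 ⟨t, ht, hgt, rfl⟩,
            nonzeroValues_cons_bump_of_ne (ne_of_mem_of_not_mem ht hm).symm hg⟩

lemma nonzeroValues_bump_injOn {l : List ℕ} (hl : l.Nodup) (g : ℕ → ℕ) {s t : ℕ}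
    (hs : s ∈ l) (ht : t ∈ l) (hgs : g s ≠ 0) (hgt : g t ≠ 0)
    (h : nonzeroValues l (bump g s) = nonzeroValues l (bump g t)) : s = t := by
  induction l with
  | nil => simp at hs
  | cons m l ih =>
    obtain ⟨hm, hl⟩ := List.nodup_cons.1 hl
    rcases List.mem_cons.1 hs with rfl | hs'
    · by_contra hne
      rw [nonzeroValues_cons_bump_self hm, nonzeroValues_cons_bump_of_ne hne hgs] at h
      simp at h
    rcases List.mem_cons.1 ht with rfl | ht'
    · by_contra hne
      rw [nonzeroValues_cons_bump_self hm, nonzeroValues_cons_bump_of_ne (Ne.symm hne) hgt] at h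
      simp at h
    have h1 : m ≠ s := fun e => hm (e ▸ hs')
    have h2 : m ≠ t := fun e => hm (e ▸ ht')
    by_cases hg : g m = 0
    · rw [nonzeroValues_cons_bump_of_ne_of_eq h1 hg,
        nonzeroValues_cons_bump_of_ne_of_eq h2 hg] at h
      exact ih hl hs' ht' h
    · rw [nonzeroValues_cons_bump_of_ne h1 hg, nonzeroValues_cons_bump_of_ne h2 hg] at h
      exact ih hl hs' ht' (List.cons.inj h).2

lemma incrementsOne_length {l L : List ℕ} (h : IncrementsOne l L) : L.length = l.length := by
  obtain ⟨j, rfl⟩ := h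
  simp

lemma step_nonzeroValues_iff {l : List ℕ} {z : ℕ} (hl : (z :: l).Nodup) {g : ℕ → ℕ}
    (hz : g z = 0) (L : List ℕ) :
    Step (nonzeroValues (z :: l) g) L ↔
      ∃ t ∈ z :: l, (t = z ∨ g t ≠ 0) ∧ L = nonzeroValues (z :: l) (bump g t) := by
  have hself : nonzeroValues (z :: l) (bump g z) = 1 :: nonzeroValues (z :: l) g := by
    rw [nonzeroValues_cons_bump_self (List.nodup_cons.1 hl).1, nonzeroValues_cons_of_eq hz, hz]
  change L = _ ∨ IncrementsOne _ L ↔ _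
  rw [incrementsOne_nonzeroValues_iff hl, ← hself]
  constructor
  · rintro (rfl | ⟨t, ht, hgt, rfl⟩)
    · exact ⟨z, List.mem_cons_self, Or.inl rfl, rfl⟩
    · exact ⟨t, ht, Or.inr hgt, rfl⟩
  · rintro ⟨t, ht, rfl | hgt, rfl⟩
    · exact Or.inl rfl
    · exact Or.inr ⟨t, ht, hgt, rfl⟩

lemma nonzeroValues_bump_injOn_of_zero {l : List ℕ} {z : ℕ} (hl : (z :: l).Nodup) {g : ℕ → ℕ}
    (hz : g z = 0) {s t : ℕ} (hs : s ∈ z :: l) (ht : t ∈ z :: l) (hgs : s = z ∨ g s ≠ 0)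
    (hgt : t = z ∨ g t ≠ 0)
    (h : nonzeroValues (z :: l) (bump g s) = nonzeroValues (z :: l) (bump g t)) : s = t := by
  have hself : (nonzeroValues (z :: l) (bump g z)).length =
      (nonzeroValues (z :: l) g).length + 1 := by
    rw [nonzeroValues_cons_bump_self (List.nodup_cons.1 hl).1, nonzeroValues_cons_of_eq hz,
      List.length_cons]
  have hlen : ∀ u ∈ z :: l, g u ≠ 0 → (nonzeroValues (z :: l) (bump g u)).length =
      (nonzeroValues (z :: l) g).length := fun u hu hgu =>
    incrementsOne_length ((incrementsOne_nonzeroValues_iff hl g _).2 ⟨u, hu, hgu, rfl⟩)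
  have h' := congrArg List.length h
  rcases hgs with rfl | hgs <;> rcases hgt with rfl | hgt
  · rfl
  · rw [hself, hlen t ht hgt] at h'; omega
  · rw [hself, hlen s hs hgs] at h'; omega
  · exact nonzeroValues_bump_injOn hl g hs ht hgs hgt h

/-! ### Block sizes of a set partition -/

lemma sup_id_eq {b : Finset ℕ} {m : ℕ} (hm : m ∈ b) (h : ∀ x ∈ b, x ≤ m) : b.sup id = m :=
  le_antisymm (Finset.sup_le h) (Finset.le_sup (f := id) hm)

lemma le_sup_id {b : Finset ℕ} {x : ℕ} (hx : x ∈ b) : x ≤ b.sup id :=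
  Finset.le_sup (f := id) hx

lemma sup_id_mem {b : Finset ℕ} (hb : b.Nonempty) : b.sup id ∈ b := by
  obtain ⟨x, hx, h⟩ := Finset.exists_mem_eq_sup b hb id
  rw [h]; exact hx

lemma isSetPartition_iff {k : ℕ} {P : Finset (Finset ℕ)} :
    IsSetPartition k P ↔ (∀ b ∈ P, b.Nonempty) ∧
      (∀ b ∈ P, ∀ c ∈ P, ∀ x, x ∈ b → x ∈ c → b = c) ∧
      ∀ x, (∃ b ∈ P, x ∈ b) ↔ 1 ≤ x ∧ x ≤ k := by
  unfold IsSetPartition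
  refine and_congr_right fun _ => and_congr ?_ ?_
  · refine forall₂_congr fun b _ => forall₂_congr fun c _ => ?_
    rw [Finset.disjoint_left]
    constructor
    · intro h x hb hc
      by_contra hne
      exact h hne hb hc
    · intro h hne x hb hc
      exact hne (h x hb hc)
  · simp [Finset.ext_iff, Finset.mem_sup]

/-- The size of the block of `P` with largest element `m`, or `0` if there is none. -/
def blockSize (P : Finset (Finset ℕ)) (m : ℕ) : ℕ :=
  P.sup fun b => if m ∈ b ∧ ∀ x ∈ b, x ≤ m then b.card else 0

lemma shape_eq_nonzeroValues {k : ℕ} {P : Finset (Finset ℕ)} (hP : IsSetPartition k P) :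
    shape P = nonzeroValues (List.range (k + 1)) (blockSize P) := by
  have h : (P.sup fun b => b.sup id) = k := by
    have hP := (isSetPartition_iff.1 hP).2.2
    apply le_antisymm
    · exact Finset.sup_le fun b hb => Finset.sup_le fun x hx => ((hP x).1 ⟨b, hb, hx⟩).2
    · rcases Nat.eq_zero_or_pos k with rfl | hk
      · exact Nat.zero_le _
      · obtain ⟨b, hb, hx⟩ := (hP k).2 ⟨hk, le_rfl⟩
        exact (le_sup_id hx).trans (Finset.le_sup (f := fun b : Finset ℕ => b.sup id) hb)
  unfold shape
  rw [h]
  rfl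

lemma blockSize_ne_zero {P : Finset (Finset ℕ)} {m : ℕ} (h : blockSize P m ≠ 0) :
    ∃ b ∈ P, b.sup id = m := by
  contrapose! h
  refine Finset.sup_eq_bot_iff _ _ |>.2 fun b hb => ?_
  rw [if_neg fun hm => h b hb (sup_id_eq hm.1 hm.2)]
  rfl

section Partition

variable {k : ℕ} {P : Finset (Finset ℕ)}

lemma sup_id_pos (hP : IsSetPartition k P) {b : Finset ℕ} (hb : b ∈ P) : 1 ≤ b.sup id :=
  have h := isSetPartition_iff.1 hP
  ((h.2.2 _).1 ⟨b, hb, sup_id_mem (h.1 b hb)⟩).1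

lemma sup_id_le (hP : IsSetPartition k P) {b : Finset ℕ} (hb : b ∈ P) : b.sup id ≤ k :=
  have h := isSetPartition_iff.1 hP
  ((h.2.2 _).1 ⟨b, hb, sup_id_mem (h.1 b hb)⟩).2

lemma zero_notMem (hP : IsSetPartition k P) {b : Finset ℕ} (hb : b ∈ P) : 0 ∉ b := fun h0 => by
  have := ((isSetPartition_iff.1 hP).2.2 0).1 ⟨b, hb, h0⟩
  omega

lemma eq_of_sup_id_eq (hP : IsSetPartition k P) {b c : Finset ℕ} (hb : b ∈ insert ∅ P)
    (hc : c ∈ insert ∅ P) (h : b.sup id = c.sup id) : b = c := by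
  have hP' := isSetPartition_iff.1 hP
  rcases Finset.mem_insert.1 hb with rfl | hb <;> rcases Finset.mem_insert.1 hc with rfl | hc
  · rfl
  · have := sup_id_pos hP hc
    rw [← h] at this; simp at this
  · have := sup_id_pos hP hb
    rw [h] at this; simp at this
  · exact hP'.2.1 b hb c hc _ (sup_id_mem (hP'.1 b hb)) (h ▸ sup_id_mem (hP'.1 c hc))

lemma blockSize_sup_id (hP : IsSetPartition k P) {b : Finset ℕ} (hb : b ∈ P) :
    blockSize P (b.sup id) = b.card := by
  have hP' := isSetPartition_iff.1 hP
  apply le_antisymm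
  · refine Finset.sup_le fun c hc => ?_
    split_ifs with h
    · rw [eq_of_sup_id_eq hP (Finset.mem_insert_of_mem hc) (Finset.mem_insert_of_mem hb)
        (sup_id_eq h.1 h.2)]
    · exact Nat.zero_le _
  · have := Finset.le_sup (f := fun c : Finset ℕ =>
      if b.sup id ∈ c ∧ ∀ x ∈ c, x ≤ b.sup id then c.card else 0) hb
    rwa [if_pos ⟨sup_id_mem (hP'.1 b hb), fun x hx => le_sup_id hx⟩] at this

lemma blockSize_zero (hP : IsSetPartition k P) : blockSize P 0 = 0 := by
  by_contra h
  obtain ⟨b, hb, h0⟩ := blockSize_ne_zero h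
  have := sup_id_pos hP hb
  omega

lemma blockSize_sup_id_of_mem_insert (hP : IsSetPartition k P) {b : Finset ℕ}
    (hb : b ∈ insert ∅ P) : blockSize P (b.sup id) = b.card := by
  rcases Finset.mem_insert.1 hb with rfl | hb
  · simpa using blockSize_zero hP
  · exact blockSize_sup_id hP hb

lemma exists_sup_id_eq_iff (hP : IsSetPartition k P) {t : ℕ} :
    (∃ b ∈ insert ∅ P, b.sup id = t) ↔ t = 0 ∨ blockSize P t ≠ 0 := by
  constructor
  · rintro ⟨b, hb, rfl⟩
    rcases Finset.mem_insert.1 hb with rfl | hb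
    · simp
    · right
      rw [blockSize_sup_id hP hb]
      exact (Finset.card_pos.2 ((isSetPartition_iff.1 hP).1 b hb)).ne'
  · rintro (rfl | h)
    · exact ⟨∅, by simp, by simp⟩
    · obtain ⟨b, hb, h⟩ := blockSize_ne_zero h
      exact ⟨b, Finset.mem_insert_of_mem hb, h⟩

end Partition

/-! ### Inserting a new smallest element -/

/-- Shift the elements of `b` up by `1`, and add the element `1` if the largest element of `b`
(`0` for `b = ∅`) is `t`. -/
def liftBlock (t : ℕ) (b : Finset ℕ) : Finset ℕ :=
  if b.sup id = t then insert 1 (b.image (· + 1)) else b.image (· + 1)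

/-- Shift the blocks of `P` up by `1`, and add the element `1` to the block whose largest element
was `t`; for `t = 0` the element `1` forms a new block. -/
def liftPartition (P : Finset (Finset ℕ)) (t : ℕ) : Finset (Finset ℕ) :=
  ((insert ∅ P).image (liftBlock t)).erase ∅

/-- Decrease the elements of `b` by `1` and delete the resulting `0`. -/
def lowerBlock (b : Finset ℕ) : Finset ℕ := (b.image fun x => x - 1).erase 0

lemma mem_liftBlock {t x : ℕ} {b : Finset ℕ} :
    x ∈ liftBlock t b ↔ (x = 1 ∧ b.sup id = t) ∨ ∃ y ∈ b, y + 1 = x := by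
  unfold liftBlock
  split_ifs with h <;> simp [h]

lemma mem_liftPartition {t : ℕ} {P : Finset (Finset ℕ)} {b : Finset ℕ} :
    b ∈ liftPartition P t ↔ b.Nonempty ∧ ∃ c ∈ insert ∅ P, liftBlock t c = b := by
  rw [liftPartition, Finset.mem_erase, Finset.mem_image, Finset.nonempty_iff_ne_empty]

lemma mem_lowerBlock {b : Finset ℕ} {x : ℕ} : x ∈ lowerBlock b ↔ x ≠ 0 ∧ x + 1 ∈ b := by
  simp only [lowerBlock, Finset.mem_erase, Finset.mem_image]
  refine and_congr_right fun hx => ⟨?_, fun h => ⟨x + 1, h, by omega⟩⟩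
  rintro ⟨y, hy, rfl⟩
  rwa [show y - 1 + 1 = y by omega]

lemma mem_pminus {P : Finset (Finset ℕ)} {b : Finset ℕ} :
    b ∈ pminus P ↔ b.Nonempty ∧ ∃ c ∈ P, lowerBlock c = b := by
  rw [pminus, Finset.mem_filter, Finset.mem_image, and_comm]
  rfl

lemma lowerBlock_liftBlock {t : ℕ} {b : Finset ℕ} (hb : 0 ∉ b) :
    lowerBlock (liftBlock t b) = b := by
  ext x
  rw [mem_lowerBlock, mem_liftBlock]
  constructor
  · rintro ⟨h0, ⟨h, -⟩ | ⟨y, hy, h⟩⟩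
    · omega
    · obtain rfl : y = x := by omega
      exact hy
  · intro hx
    exact ⟨fun h => hb (h ▸ hx), Or.inr ⟨x, hx, rfl⟩⟩

lemma sup_id_liftBlock {t : ℕ} {b : Finset ℕ} (h : (liftBlock t b).Nonempty) :
    (liftBlock t b).sup id = b.sup id + 1 := by
  apply sup_id_eq
  · rw [mem_liftBlock]
    rcases b.eq_empty_or_nonempty with rfl | hb
    · obtain ⟨x, hx⟩ := h
      rw [mem_liftBlock] at hx
      exact Or.inl ⟨rfl, (hx.resolve_right (by simp)).2⟩
    · exact Or.inr ⟨_, sup_id_mem hb, rfl⟩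
  · intro x hx
    rcases mem_liftBlock.1 hx with ⟨rfl, -⟩ | ⟨y, hy, rfl⟩
    · omega
    · have := le_sup_id hy
      omega

lemma card_liftBlock {t : ℕ} {b : Finset ℕ} (hb : 0 ∉ b) :
    (liftBlock t b).card = b.card + if b.sup id = t then 1 else 0 := by
  have hc : (b.image (· + 1)).card = b.card :=
    Finset.card_image_of_injective _ (add_left_injective 1)
  unfold liftBlock
  split_ifs
  · rw [Finset.card_insert_of_notMem (by simpa using hb), hc]
  · exact hc

lemma liftBlock_nonempty {t : ℕ} {b : Finset ℕ} (h : b.Nonempty ∨ b.sup id = t) :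
    (liftBlock t b).Nonempty := by
  rcases h with ⟨x, hx⟩ | h
  · exact ⟨x + 1, mem_liftBlock.2 (Or.inr ⟨x, hx, rfl⟩)⟩
  · exact ⟨1, mem_liftBlock.2 (Or.inl ⟨rfl, h⟩)⟩

section Lift

variable {k : ℕ} {P : Finset (Finset ℕ)}

lemma zero_notMem_of_mem_insert (hP : IsSetPartition k P) {b : Finset ℕ} (hb : b ∈ insert ∅ P) :
    0 ∉ b := by
  rcases Finset.mem_insert.1 hb with rfl | hb
  · simp
  · exact zero_notMem hP hb

lemma isSetPartition_liftPartition (hP : IsSetPartition k P) {t : ℕ}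
    (ht : t = 0 ∨ blockSize P t ≠ 0) : IsSetPartition (k + 1) (liftPartition P t) := by
  have hP' := isSetPartition_iff.1 hP
  refine isSetPartition_iff.2 ⟨fun b hb => (mem_liftPartition.1 hb).1, ?_, ?_⟩
  · intro b hb c hc x hxb hxc
    rw [mem_liftPartition] at hb
    obtain ⟨-, b, hb, rfl⟩ := hb
    rw [mem_liftPartition] at hc
    obtain ⟨-, c, hc, rfl⟩ := hc
    congr 1
    rcases mem_liftBlock.1 hxb with ⟨h1, h2⟩ | ⟨y, hy, rfl⟩ <;>
      rcases mem_liftBlock.1 hxc with ⟨h3, h4⟩ | ⟨z, hz, h⟩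
    · exact eq_of_sup_id_eq hP hb hc (h2.trans h4.symm)
    · obtain rfl : z = 0 := by omega
      exact absurd hz (zero_notMem_of_mem_insert hP hc)
    · obtain rfl : y = 0 := by omega
      exact absurd hy (zero_notMem_of_mem_insert hP hb)
    · obtain rfl : z = y := by omega
      rcases Finset.mem_insert.1 hb with rfl | hb
      · simp at hy
      rcases Finset.mem_insert.1 hc with rfl | hc
      · simp at hz
      exact hP'.2.1 b hb c hc _ hy hz
  · intro x
    constructor
    · rintro ⟨b, hb, hx⟩
      rw [mem_liftPartition] at hb
      obtain ⟨-, b, hb, rfl⟩ := hb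
      rcases mem_liftBlock.1 hx with ⟨h1, -⟩ | ⟨y, hy, rfl⟩
      · omega
      · rcases Finset.mem_insert.1 hb with rfl | hb
        · simp at hy
        · have := (hP'.2.2 y).1 ⟨b, hb, hy⟩
          omega
    · rintro ⟨h1, h2⟩
      rcases h1.eq_or_lt with rfl | h1
      · obtain ⟨b, hb, h⟩ := (exists_sup_id_eq_iff hP).2 ht
        exact ⟨_, mem_liftPartition.2 ⟨liftBlock_nonempty (Or.inr h), b, hb, rfl⟩,
          mem_liftBlock.2 (Or.inl ⟨rfl, h⟩)⟩
      · obtain ⟨b, hb, h⟩ := (hP'.2.2 (x - 1)).2 ⟨by omega, by omega⟩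
        exact ⟨_, mem_liftPartition.2 ⟨liftBlock_nonempty (Or.inl ⟨_, h⟩), b,
          Finset.mem_insert_of_mem hb, rfl⟩, mem_liftBlock.2 (Or.inr ⟨_, h, by omega⟩)⟩

lemma pminus_liftPartition (hP : IsSetPartition k P) (t : ℕ) :
    pminus (liftPartition P t) = P := by
  have hP' := isSetPartition_iff.1 hP
  ext b
  rw [mem_pminus]
  constructor
  · rintro ⟨hne, c, hc, rfl⟩
    rw [mem_liftPartition] at hc
    obtain ⟨-, c, hc, rfl⟩ := hc
    rw [lowerBlock_liftBlock (zero_notMem_of_mem_insert hP hc)] at hne ⊢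
    exact (Finset.mem_insert.1 hc).resolve_left hne.ne_empty
  · intro hb
    exact ⟨hP'.1 b hb, _, mem_liftPartition.2 ⟨liftBlock_nonempty (Or.inl (hP'.1 b hb)), b,
      Finset.mem_insert_of_mem hb, rfl⟩, lowerBlock_liftBlock (zero_notMem hP hb)⟩

lemma blockSize_liftPartition (hP : IsSetPartition k P) {t : ℕ}
    (ht : t = 0 ∨ blockSize P t ≠ 0) (m : ℕ) :
    blockSize (liftPartition P t) (m + 1) = bump (blockSize P) t m := by
  have hL := isSetPartition_liftPartition hP ht
  have key : ∀ b ∈ insert ∅ P, (liftBlock t b).Nonempty →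
      blockSize (liftPartition P t) (b.sup id + 1) = bump (blockSize P) t (b.sup id) := by
    intro b hb hne
    rw [← sup_id_liftBlock hne, blockSize_sup_id hL (mem_liftPartition.2 ⟨hne, b, hb, rfl⟩),
      card_liftBlock (zero_notMem_of_mem_insert hP hb), bump,
      blockSize_sup_id_of_mem_insert hP hb]
  by_cases h : blockSize (liftPartition P t) (m + 1) = 0
  · by_contra hne
    have hm : m = t ∨ blockSize P m ≠ 0 := by
      rw [h, bump] at hne
      by_contra! hcon
      simp [hcon] at hne
    have hm' : m = 0 ∨ blockSize P m ≠ 0 := by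
      rcases hm with rfl | hm
      · exact ht
      · exact Or.inr hm
    obtain ⟨b, hb, rfl⟩ := (exists_sup_id_eq_iff hP).2 hm'
    refine hne (key b hb (liftBlock_nonempty ?_))
    rcases hm with hm | hm
    · exact Or.inr hm
    · rw [blockSize_sup_id_of_mem_insert hP hb] at hm
      exact Or.inl (Finset.card_ne_zero.1 hm)
  · obtain ⟨b, hb, hs⟩ := blockSize_ne_zero h
    rw [mem_liftPartition] at hb
    obtain ⟨hne, b, hb, rfl⟩ := hb
    rw [sup_id_liftBlock hne] at hs
    obtain rfl : b.sup id = m := by omega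
    exact key b hb hne

lemma shape_liftPartition (hP : IsSetPartition k P) {t : ℕ}
    (ht : t = 0 ∨ blockSize P t ≠ 0) :
    shape (liftPartition P t) = nonzeroValues (List.range (k + 1)) (bump (blockSize P) t) := by
  have hL := isSetPartition_liftPartition hP ht
  rw [shape_eq_nonzeroValues hL, List.range_succ_eq_map (n := k + 1),
    nonzeroValues_cons_of_eq (blockSize_zero hL), nonzeroValues, nonzeroValues,
    List.filterMap_map]
  simp only [Function.comp_def, Nat.succ_eq_add_one, blockSize_liftPartition hP ht]

lemma range_succ_eq_cons (k : ℕ) : List.range (k + 1) = 0 :: (List.range k).map Nat.succ :=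
  List.range_succ_eq_map

lemma lt_succ_of_blockSize (hP : IsSetPartition k P) {t : ℕ}
    (ht : t = 0 ∨ blockSize P t ≠ 0) : t < k + 1 := by
  rcases ht with rfl | ht
  · omega
  · obtain ⟨b, hb, rfl⟩ := blockSize_ne_zero ht
    exact Nat.lt_succ_of_le (sup_id_le hP hb)

lemma step_shape_iff (hP : IsSetPartition k P) (L : List ℕ) :
    Step (shape P) L ↔ ∃ t, (t = 0 ∨ blockSize P t ≠ 0) ∧ shape (liftPartition P t) = L := by
  have hnd : (List.range (k + 1)).Nodup := List.nodup_range
  rw [shape_eq_nonzeroValues hP, range_succ_eq_cons,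
    step_nonzeroValues_iff (range_succ_eq_cons k ▸ hnd) (blockSize_zero hP)]
  constructor
  · rintro ⟨t, -, ht, rfl⟩
    exact ⟨t, ht, by rw [shape_liftPartition hP ht, range_succ_eq_cons]⟩
  · rintro ⟨t, ht, rfl⟩
    refine ⟨t, ?_, ht, by rw [shape_liftPartition hP ht, range_succ_eq_cons]⟩
    rw [← range_succ_eq_cons, List.mem_range]
    exact lt_succ_of_blockSize hP ht

lemma shape_liftPartition_injOn (hP : IsSetPartition k P) {s t : ℕ}
    (hs : s = 0 ∨ blockSize P s ≠ 0) (ht : t = 0 ∨ blockSize P t ≠ 0)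
    (h : shape (liftPartition P s) = shape (liftPartition P t)) : s = t := by
  have hnd : (List.range (k + 1)).Nodup := List.nodup_range
  have hs' := List.mem_range.2 (lt_succ_of_blockSize hP hs)
  have ht' := List.mem_range.2 (lt_succ_of_blockSize hP ht)
  rw [shape_liftPartition hP hs, shape_liftPartition hP ht] at h
  rw [range_succ_eq_cons] at h hs' ht' hnd
  exact nonzeroValues_bump_injOn_of_zero hnd (blockSize_zero hP) hs' ht' hs ht h

lemma lowerBlock_mem_insert_pminus {b : Finset ℕ} (hb : b ∈ P) :
    lowerBlock b ∈ insert ∅ (pminus P) := by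
  rw [Finset.mem_insert, mem_pminus, ← Finset.not_nonempty_iff_eq_empty]
  by_cases h : (lowerBlock b).Nonempty
  · exact Or.inr ⟨h, b, hb, rfl⟩
  · exact Or.inl h

lemma isSetPartition_pminus (hP : IsSetPartition (k + 1) P) : IsSetPartition k (pminus P) := by
  have hP' := isSetPartition_iff.1 hP
  refine isSetPartition_iff.2 ⟨fun b hb => (mem_pminus.1 hb).1, ?_, ?_⟩
  · intro b hb c hc x hxb hxc
    rw [mem_pminus] at hb
    obtain ⟨-, b, hb, rfl⟩ := hb
    rw [mem_pminus] at hc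
    obtain ⟨-, c, hc, rfl⟩ := hc
    rw [hP'.2.1 b hb c hc _ (mem_lowerBlock.1 hxb).2 (mem_lowerBlock.1 hxc).2]
  · intro x
    constructor
    · rintro ⟨b, hb, hx⟩
      rw [mem_pminus] at hb
      obtain ⟨-, b, hb, rfl⟩ := hb
      have hx := mem_lowerBlock.1 hx
      have := (hP'.2.2 _).1 ⟨b, hb, hx.2⟩
      omega
    · rintro ⟨h1, h2⟩
      obtain ⟨b, hb, hx⟩ := (hP'.2.2 (x + 1)).2 ⟨by omega, by omega⟩
      have hx' : x ∈ lowerBlock b := mem_lowerBlock.2 ⟨by omega, hx⟩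
      exact ⟨_, mem_pminus.2 ⟨⟨x, hx'⟩, b, hb, rfl⟩, hx'⟩

lemma sup_id_lowerBlock (hP : IsSetPartition k P) {b : Finset ℕ} (hb : b ∈ P) :
    (lowerBlock b).sup id + 1 = b.sup id := by
  have hpos := sup_id_pos hP hb
  have hmem := sup_id_mem ((isSetPartition_iff.1 hP).1 b hb)
  have hle : (lowerBlock b).sup id ≤ b.sup id - 1 := Finset.sup_le fun x hx => by
    have := le_sup_id (mem_lowerBlock.1 hx).2
    simp only [id]; omega
  have hge : b.sup id - 1 ≤ (lowerBlock b).sup id := by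
    rcases hpos.eq_or_lt with h | h
    · omega
    · exact le_sup_id (mem_lowerBlock.2 ⟨by omega, by rwa [Nat.sub_add_cancel hpos]⟩)
  omega

lemma liftBlock_lowerBlock (hP : IsSetPartition k P) {b c : Finset ℕ} (hc : c ∈ P) (hb : b ∈ P)
    (h1 : 1 ∈ c) : liftBlock ((lowerBlock c).sup id) (lowerBlock b) = b := by
  have hsup : (lowerBlock b).sup id = (lowerBlock c).sup id ↔ b = c := by
    constructor
    · intro h
      apply eq_of_sup_id_eq hP (Finset.mem_insert_of_mem hb) (Finset.mem_insert_of_mem hc)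
      rw [← sup_id_lowerBlock hP hb, ← sup_id_lowerBlock hP hc, h]
    · rintro rfl; rfl
  ext x
  rw [mem_liftBlock, hsup]
  constructor
  · rintro (⟨rfl, rfl⟩ | ⟨y, hy, rfl⟩)
    · exact h1
    · exact (mem_lowerBlock.1 hy).2
  · intro hx
    have h0 : x ≠ 0 := fun h => zero_notMem hP hb (h ▸ hx)
    by_cases hx1 : x = 1
    · subst hx1
      exact Or.inl ⟨rfl, (isSetPartition_iff.1 hP).2.1 b hb c hc 1 hx h1⟩
    · have hxe : x - 1 + 1 = x := by omega
      exact Or.inr ⟨x - 1, mem_lowerBlock.2 ⟨by omega, by rwa [hxe]⟩, hxe⟩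

lemma exists_eq_liftPartition_pminus (hP : IsSetPartition (k + 1) P) :
    ∃ t, (t = 0 ∨ blockSize (pminus P) t ≠ 0) ∧ liftPartition (pminus P) t = P := by
  have hP' := isSetPartition_iff.1 hP
  obtain ⟨c, hc, h1⟩ := (hP'.2.2 1).2 ⟨le_rfl, by omega⟩
  have hQ := isSetPartition_pminus hP
  refine ⟨(lowerBlock c).sup id,
    (exists_sup_id_eq_iff hQ).1 ⟨_, lowerBlock_mem_insert_pminus hc, rfl⟩, ?_⟩
  ext b
  rw [mem_liftPartition]
  constructor
  · rintro ⟨hne, d, hd, rfl⟩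
    rcases Finset.mem_insert.1 hd with rfl | hd
    · obtain ⟨x, hx⟩ := hne
      rcases mem_liftBlock.1 hx with ⟨-, hs⟩ | ⟨y, hy, -⟩
      · rw [eq_of_sup_id_eq hQ (Finset.mem_insert_self _ _) (lowerBlock_mem_insert_pminus hc) hs,
          liftBlock_lowerBlock hP hc hc h1]
        exact hc
      · simp at hy
    · rw [mem_pminus] at hd
      obtain ⟨-, e, he, rfl⟩ := hd
      rwa [liftBlock_lowerBlock hP hc he h1]
  · intro hb
    exact ⟨hP'.1 b hb, _, lowerBlock_mem_insert_pminus hb, liftBlock_lowerBlock hP hc hb h1⟩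

end Lift

/-! ### Chains and set partitions -/

/-- Chains of length `k` starting at the empty composition. -/
abbrev Chain (k : ℕ) : Type :=
  {c : Fin (k + 1) → List ℕ // c 0 = [] ∧ ∀ i : Fin k, Step (c i.castSucc) (c i.succ)}

/-- A chain of length `k + 1` is a chain of length `k` with one more step. -/
def chainSuccEquiv (k : ℕ) :
    Chain (k + 1) ≃ Σ c : Chain k, {L : List ℕ // Step (c.1 (Fin.last k)) L} where
  toFun c := ⟨⟨fun i => c.1 i.castSucc, c.2.1, fun i => c.2.2 i.castSucc⟩,
    c.1 (Fin.last (k + 1)), c.2.2 (Fin.last k)⟩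
  invFun p := ⟨Fin.snoc (α := fun _ => List ℕ) p.1.1 p.2.1, by
    refine ⟨?_, fun i => ?_⟩
    · change Fin.snoc (α := fun _ => List ℕ) p.1.1 p.2.1 (Fin.castSucc 0) = []
      rw [Fin.snoc_castSucc (α := fun _ => List ℕ)]
      exact p.1.2.1
    · refine Fin.lastCases ?_ (fun j => ?_) i
      · rw [Fin.snoc_castSucc (α := fun _ => List ℕ), Fin.succ_last,
          Fin.snoc_last (α := fun _ => List ℕ)]
        exact p.2.2
      · rw [Fin.snoc_castSucc (α := fun _ => List ℕ), Fin.succ_castSucc,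
          Fin.snoc_castSucc (α := fun _ => List ℕ)]
        exact p.1.2.2 j⟩
  left_inv c := Subtype.ext (Fin.snoc_init_self (α := fun _ => List ℕ) c.1)
  right_inv := by
    rintro ⟨⟨c, hc⟩, L, hL⟩
    exact Sigma.subtype_ext
      (Subtype.ext (funext fun i => Fin.snoc_castSucc (α := fun _ => List ℕ) L c i))
      (Fin.snoc_last (α := fun _ => List ℕ) L c)

/-- A set partition of `[k + 1]` amounts to a set partition `Q` of `[k]` and a composition `L`
with `shape Q → L`. -/
noncomputable def partitionSuccEquiv (k : ℕ) :
    {P // IsSetPartition (k + 1) P} ≃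
      Σ Q : {Q // IsSetPartition k Q}, {L : List ℕ // Step (shape Q.1) L} :=
  Equiv.ofBijective
    (fun P => ⟨⟨pminus P.1, isSetPartition_pminus P.2⟩, shape P.1, by
      obtain ⟨t, ht, h⟩ := exists_eq_liftPartition_pminus P.2
      exact (step_shape_iff (isSetPartition_pminus P.2) _).2 ⟨t, ht, by rw [h]⟩⟩) <| by
    constructor
    · rintro ⟨P, hP⟩ ⟨P', hP'⟩ h
      have h1 : pminus P = pminus P' := congrArg (fun p => p.1.1) h
      have h2 : shape P = shape P' := congrArg (fun p => p.2.1) h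
      obtain ⟨t, ht, hPt⟩ := exists_eq_liftPartition_pminus hP
      obtain ⟨t', ht', hPt'⟩ := exists_eq_liftPartition_pminus hP'
      rw [← h1] at ht' hPt'
      have : t = t' := shape_liftPartition_injOn (isSetPartition_pminus hP) ht ht'
        (by rw [hPt, hPt', h2])
      exact Subtype.ext (hPt.symm.trans (this ▸ hPt'))
    · rintro ⟨⟨Q, hQ⟩, L, hL⟩
      obtain ⟨t, ht, rfl⟩ := (step_shape_iff hQ L).1 hL
      refine ⟨⟨liftPartition Q t, isSetPartition_liftPartition hQ ht⟩, ?_⟩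
      have h1 := pminus_liftPartition hQ t
      refine Sigma.subtype_ext (Subtype.ext h1) rfl

lemma isSetPartition_zero_iff {P : Finset (Finset ℕ)} : IsSetPartition 0 P ↔ P = ∅ := by
  constructor
  · intro h
    refine Finset.eq_empty_of_forall_notMem fun b hb => ?_
    have h1 := sup_id_pos h hb
    have h2 := sup_id_le h hb
    omega
  · rintro rfl
    simp [IsSetPartition]

lemma exists_chain_equiv_partition (k : ℕ) :
    ∃ e : Chain k ≃ {P // IsSetPartition k P}, ∀ c, shape (e c).1 = c.1 (Fin.last k) := by
  induction k with
  | zero =>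
    refine ⟨⟨fun _ => ⟨∅, isSetPartition_zero_iff.2 rfl⟩,
      fun _ => ⟨fun _ => [], rfl, fun i => i.elim0⟩, ?_, ?_⟩, ?_⟩
    · rintro ⟨c, hc⟩
      refine Subtype.ext (funext fun i => ?_)
      obtain rfl : i = 0 := Fin.fin_one_eq_zero i
      exact hc.1.symm
    · rintro ⟨P, hP⟩
      exact Subtype.ext (isSetPartition_zero_iff.1 hP).symm
    · rintro ⟨c, hc⟩
      change shape ∅ = c 0
      rw [hc.1]
      simp [shape]
  | succ k ih =>
    obtain ⟨e, he⟩ := ih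
    refine ⟨(chainSuccEquiv k).trans ((Equiv.sigmaCongr e fun c =>
      Equiv.subtypeEquivRight fun L => by rw [he c]).trans (partitionSuccEquiv k).symm),
      fun c => ?_⟩
    set p := (Equiv.sigmaCongr (β₂ := fun Q : {Q // IsSetPartition k Q} =>
      {L : List ℕ // Step (shape Q.1) L}) e fun c =>
      Equiv.subtypeEquivRight fun L => by rw [he c]) (chainSuccEquiv k c)
    change shape ((partitionSuccEquiv k).symm p).1 = _
    exact congrArg (fun q => q.2.1) ((partitionSuccEquiv k).apply_symm_apply p)

end SetPartitionShape

/-- For every composition `Λ` of `k`, the number of chains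
`() = λ⁰ → λ¹ → ⋯ → λᵏ = Λ` equals the number of set partitions of `[k]`
of shape `Λ`. -/
theorem card_chains_eq_card_partitions (k : ℕ) (Lam : List ℕ)
    (hpos : ∀ x ∈ Lam, 0 < x) (hsum : Lam.sum = k) :
    Nat.card {c : Fin (k + 1) → List ℕ //
        c 0 = [] ∧ c (Fin.last k) = Lam ∧
          ∀ i : Fin k, Step (c i.castSucc) (c i.succ)}
      = Nat.card {P : Finset (Finset ℕ) // IsSetPartition k P ∧ shape P = Lam} := by
  obtain ⟨e, he⟩ := SetPartitionShape.exists_chain_equiv_partition k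
  have e₁ := Equiv.subtypeSubtypeEquivSubtypeInter
    (fun c : Fin (k + 1) → List ℕ => c 0 = [] ∧ ∀ i : Fin k, Step (c i.castSucc) (c i.succ))
    (fun c => c (Fin.last k) = Lam)
  have e₂ := Equiv.subtypeSubtypeEquivSubtypeInter (IsSetPartition k) (fun P => shape P = Lam)
  have e₃ : {c : SetPartitionShape.Chain k // c.1 (Fin.last k) = Lam} ≃
      {P : {P // IsSetPartition k P} // shape P.1 = Lam} :=
    e.subtypeEquiv fun c => by rw [he c]
  refine Nat.card_congr (((Equiv.subtypeEquivRight fun c => ?_).trans e₁.symm).trans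
    (e₃.trans e₂))
  tauto
end

section
/- For every integer k ≥ 1 and every set partition Π of [k], the relation shape(Π^-) → shape(Π) holds. -/
/-- The size of `b` if `m` is its largest element, and `0` otherwise. -/
def cardIfMax (b : Finset ℕ) (m : ℕ) : ℕ :=
  if m ∈ b ∧ ∀ x ∈ b, x ≤ m then b.card else 0

/-- `some c` for nonzero `c`, and `none` for `0`. -/
def nonzeroPart (c : ℕ) : Option ℕ := if c = 0 then none else some c

/-- The image of a block under the decrementing operation `Π ↦ Π⁻`. -/
def blockMinus (b : Finset ℕ) : Finset ℕ := (b.image fun x => x - 1).erase 0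

theorem mem_blockMinus {b : Finset ℕ} {m : ℕ} : m ∈ blockMinus b ↔ m ≠ 0 ∧ m + 1 ∈ b := by
  simp only [blockMinus, Finset.mem_erase, Finset.mem_image]
  refine and_congr_right fun hm => ⟨?_, fun h => ⟨m + 1, h, rfl⟩⟩
  rintro ⟨x, hx, rfl⟩
  rwa [Nat.sub_add_cancel (by omega)]

theorem card_blockMinus {b : Finset ℕ} (h0 : 0 ∉ b) : (blockMinus b).card = (b.erase 1).card := by
  have himage : (blockMinus b).image (· + 1) = b.erase 1 := by
    ext x
    simp only [Finset.mem_image, mem_blockMinus, Finset.mem_erase]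
    constructor
    · rintro ⟨y, ⟨hy, hyb⟩, rfl⟩
      exact ⟨by omega, hyb⟩
    · rintro ⟨hx, hxb⟩
      have hx0 : x ≠ 0 := fun h => h0 (h ▸ hxb)
      have hxs : x - 1 + 1 = x := by omega
      exact ⟨x - 1, ⟨by omega, by rwa [hxs]⟩, hxs⟩
  rw [← himage, Finset.card_image_of_injective _ (add_left_injective 1)]

theorem cardIfMax_blockMinus {b : Finset ℕ} (h0 : 0 ∉ b) (h1 : 1 ∉ b) (m : ℕ) :
    cardIfMax b (m + 1) = cardIfMax (blockMinus b) m := by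
  have hiff : (m + 1 ∈ b ∧ ∀ x ∈ b, x ≤ m + 1) ↔
      (m ∈ blockMinus b ∧ ∀ x ∈ blockMinus b, x ≤ m) := by
    simp only [mem_blockMinus]
    constructor
    · rintro ⟨hm, hle⟩
      refine ⟨⟨?_, hm⟩, fun x hx => by have := hle _ hx.2; omega⟩
      rintro rfl
      exact h1 hm
    · rintro ⟨⟨-, hm⟩, hle⟩
      refine ⟨hm, fun x hx => ?_⟩
      by_contra! hlt
      have := hle (x - 1) ⟨by omega, by rwa [Nat.sub_add_cancel (by omega)]⟩
      omega
  simp only [cardIfMax, hiff, card_blockMinus h0, Finset.erase_eq_of_notMem h1]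

theorem cardIfMax_eq_zero_of_ne {b : Finset ℕ} {m n : ℕ} (hm : m ∈ b) (hmax : ∀ x ∈ b, x ≤ m)
    (hne : n ≠ m) : cardIfMax b n = 0 :=
  if_neg fun h => hne (le_antisymm (hmax _ h.1) (h.2 _ hm))

theorem cardIfMax_eq_zero_of_notMem {b : Finset ℕ} {m : ℕ} (hm : m ∉ b) : cardIfMax b m = 0 :=
  if_neg fun h => hm h.1

theorem cardIfMax_blockMinus_eq_zero_of_ne {b : Finset ℕ} {m n : ℕ} (hm : m + 1 ∈ b)
    (hmax : ∀ x ∈ b, x ≤ m + 1) (hne : n ≠ m) : cardIfMax (blockMinus b) n = 0 := by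
  refine if_neg fun h => hne ?_
  have hn := mem_blockMinus.1 h.1
  have hle := hmax _ hn.2
  have := h.2 m (mem_blockMinus.2 ⟨by omega, hm⟩)
  omega

theorem cardIfMax_blockMinus_of_max {b : Finset ℕ} (h0 : 0 ∉ b) (h1 : 1 ∈ b) {m : ℕ}
    (hm : m + 1 ∈ b) (hmax : ∀ x ∈ b, x ≤ m + 1) :
    cardIfMax (blockMinus b) m = b.card - 1 := by
  rw [← Finset.card_erase_of_mem h1, ← card_blockMinus h0]
  unfold cardIfMax
  split_ifs with h
  · rfl
  · refine (Finset.card_eq_zero.2 (Finset.eq_empty_of_forall_notMem fun x hx => h ?_)).symm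
    have hle : ∀ y ∈ blockMinus b, y ≤ m := fun y hy => by
      have := hmax _ (mem_blockMinus.1 hy).2
      omega
    have hx0 := (mem_blockMinus.1 hx).1
    have hxm := hle x hx
    exact ⟨mem_blockMinus.2 ⟨by omega, hm⟩, hle⟩

theorem Finset.sup_eq_of_forall_ne {ι : Type*} {s : Finset ι} {f : ι → ℕ} {i : ι} (hi : i ∈ s)
    (h : ∀ j ∈ s, j ≠ i → f j = 0) : s.sup f = f i := by
  refine le_antisymm (Finset.sup_le fun j hj => ?_) (Finset.le_sup hi)
  by_cases hji : j = i
  · rw [hji]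
  · rw [h j hj hji]
    exact Nat.zero_le _

theorem sup_pminus (P : Finset (Finset ℕ)) {f : Finset ℕ → ℕ} (hf : f ∅ = 0) :
    (pminus P).sup f = P.sup fun b => f (blockMinus b) := by
  apply le_antisymm
  · refine Finset.sup_le fun c hc => ?_
    obtain ⟨b, hb, rfl⟩ := Finset.mem_image.1 (Finset.mem_filter.1 hc).1
    exact Finset.le_sup (f := fun b => f (blockMinus b)) hb
  · refine Finset.sup_le fun b hb => ?_
    rcases (blockMinus b).eq_empty_or_nonempty with he | hne
    · simp [he, hf]
    · exact Finset.le_sup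
        (Finset.mem_filter.2 ⟨Finset.mem_image.2 ⟨b, hb, rfl⟩, hne⟩)

theorem shape_eq (P : Finset (Finset ℕ)) :
    shape P = (List.range ((P.sup fun b => b.sup id) + 1)).filterMap fun m =>
      nonzeroPart (P.sup fun b => cardIfMax b m) := rfl

theorem shape_pminus (P : Finset (Finset ℕ)) :
    shape (pminus P) = (List.range ((P.sup fun b => (blockMinus b).sup id) + 1)).filterMap fun m =>
      nonzeroPart (P.sup fun b => cardIfMax (blockMinus b) m) := by
  rw [shape_eq, sup_pminus P (f := fun b => b.sup id) (by simp)]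
  congr 1
  funext m
  rw [sup_pminus P (f := fun b => cardIfMax b m) (by simp [cardIfMax])]

/-- Increasing one value by `1` in a sequence gives a `Step` between the lists of nonzero values,
provided that only the value at `0` may change from zero. -/
theorem step_filterMap_range {n i : ℕ} (hi : i < n) {f g : ℕ → ℕ} (hne : ∀ m, m ≠ i → f m = g m)
    (heq : f i = g i + 1) (hzero : g i = 0 → i = 0) :
    Step ((List.range n).filterMap fun m => nonzeroPart (g m))
      ((List.range n).filterMap fun m => nonzeroPart (f m)) := by
  obtain ⟨r, rfl⟩ := Nat.exists_eq_add_of_lt hi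
  have hsplit : List.range (i + r + 1) =
      List.range i ++ i :: (List.range r).map fun x => i + 1 + x := by
    rw [show i + r + 1 = i + (1 + r) by omega, List.range_add, Nat.add_comm 1 r,
      List.range_succ_eq_map]
    simp [Function.comp_def, Nat.add_comm, Nat.add_left_comm]
  have hleft : (List.range i).filterMap (fun m => nonzeroPart (f m)) =
      (List.range i).filterMap (fun m => nonzeroPart (g m)) :=
    List.filterMap_congr fun m hm => by rw [hne m (List.mem_range.1 hm).ne]
  have hright : ((List.range r).map fun x => i + 1 + x).filterMap (fun m => nonzeroPart (f m)) =
      ((List.range r).map fun x => i + 1 + x).filterMap (fun m => nonzeroPart (g m)) :=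
    List.filterMap_congr fun m hm => by
      obtain ⟨x, -, rfl⟩ := List.mem_map.1 hm
      rw [hne _ (by omega)]
  have hfi : nonzeroPart (f i) = some (g i + 1) := by simp [nonzeroPart, heq]
  rw [hsplit, List.filterMap_append, List.filterMap_append, hleft,
    List.filterMap_cons_some (f := fun m => nonzeroPart (f m)) hfi, hright]
  by_cases hg : g i = 0
  · left
    rw [List.filterMap_cons_none (by simp [nonzeroPart, hg]), hg]
    simp [hzero hg]
  · right
    rw [List.filterMap_cons_some (f := fun m => nonzeroPart (g m)) (b := g i)
      (by simp [nonzeroPart, hg])]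
    exact ⟨⟨((List.range i).filterMap fun m => nonzeroPart (g m)).length, by simp⟩, by simp⟩

namespace IsSetPartition

variable {k : ℕ} {P : Finset (Finset ℕ)}

theorem mem_Icc (hP : IsSetPartition k P) {b : Finset ℕ} (hb : b ∈ P) {x : ℕ} (hx : x ∈ b) :
    1 ≤ x ∧ x ≤ k := by
  rw [← Finset.mem_Icc, ← hP.2.2]
  exact Finset.mem_sup.2 ⟨b, hb, hx⟩

theorem exists_mem (hP : IsSetPartition k P) {x : ℕ} (h1 : 1 ≤ x) (hk : x ≤ k) :
    ∃ b ∈ P, x ∈ b := by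
  have hx := Finset.mem_Icc.2 ⟨h1, hk⟩
  rw [← hP.2.2] at hx
  exact Finset.mem_sup.1 hx

theorem sup_sup (hP : IsSetPartition k P) (hk : 1 ≤ k) : (P.sup fun b => b.sup id) = k := by
  apply le_antisymm
  · exact Finset.sup_le fun b hb => Finset.sup_le fun x hx => (hP.mem_Icc hb hx).2
  · obtain ⟨b, hb, hkb⟩ := hP.exists_mem hk le_rfl
    exact (Finset.le_sup (f := id) hkb).trans
      (Finset.le_sup (f := fun b : Finset ℕ => b.sup id) hb)

theorem sup_sup_blockMinus (hP : IsSetPartition k P) (hk : 1 ≤ k) :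
    (P.sup fun b => (blockMinus b).sup id) = k - 1 := by
  apply le_antisymm
  · refine Finset.sup_le fun b hb => Finset.sup_le fun x hx => ?_
    have := (hP.mem_Icc hb (mem_blockMinus.1 hx).2).2
    simp only [id]
    omega
  · obtain ⟨b, hb, hkb⟩ := hP.exists_mem hk le_rfl
    by_cases hk1 : k - 1 = 0
    · simp [hk1]
    · have hmem : k - 1 ∈ blockMinus b :=
        mem_blockMinus.2 ⟨hk1, by rwa [Nat.sub_add_cancel hk]⟩
      exact (Finset.le_sup (f := id) hmem).trans
        (Finset.le_sup (f := fun b : Finset ℕ => (blockMinus b).sup id) hb)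

theorem zero_notMem (hP : IsSetPartition k P) {b : Finset ℕ} (hb : b ∈ P) : 0 ∉ b := fun h =>
  absurd (hP.mem_Icc hb h).1 (by omega)

theorem shape_eq_filterMap (hP : IsSetPartition k P) (hk : 1 ≤ k) :
    shape P = (List.range k).filterMap fun m =>
      nonzeroPart (P.sup fun b => cardIfMax b (m + 1)) := by
  have hzero : (P.sup fun b => cardIfMax b 0) = 0 :=
    Nat.le_zero.1 (Finset.sup_le fun b hb =>
      (cardIfMax_eq_zero_of_notMem (hP.zero_notMem hb)).le)
  rw [shape_eq, hP.sup_sup hk, List.range_succ_eq_map,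
    List.filterMap_cons_none (by simp [nonzeroPart, hzero]), List.filterMap_map]
  rfl

end IsSetPartition

/-- For every `k ≥ 1` and every set partition `Π` of `[k]`, the relation
`shape(Π⁻) → shape(Π)` holds. -/
theorem step_shape_pminus (k : ℕ) (hk : 1 ≤ k)
    (P : Finset (Finset ℕ)) (hP : IsSetPartition k P) :
    Step (shape (pminus P)) (shape P) := by
  obtain ⟨b₀, hb₀, h1⟩ := hP.exists_mem le_rfl hk
  obtain ⟨i, hi, hmax⟩ : ∃ i, i + 1 ∈ b₀ ∧ ∀ x ∈ b₀, x ≤ i + 1 := by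
    have hne : b₀.Nonempty := ⟨1, h1⟩
    have hpos := (hP.mem_Icc hb₀ (b₀.max'_mem hne)).1
    refine ⟨b₀.max' hne - 1, ?_⟩
    rw [Nat.sub_add_cancel hpos]
    exact ⟨b₀.max'_mem hne, fun x hx => b₀.le_max' x hx⟩
  have hnotMem : ∀ {x}, x ∈ b₀ → ∀ b ∈ P, b ≠ b₀ → x ∉ b := fun hx b hb hne hxb =>
    Finset.disjoint_left.1 (hP.2.1 b hb b₀ hb₀ hne) hxb hx
  have hik : i < k := (hP.mem_Icc hb₀ hi).2
  have hcard : 0 < b₀.card := Finset.card_pos.2 ⟨1, h1⟩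
  have hvalue : (P.sup fun b => cardIfMax b (i + 1)) = b₀.card := by
    rw [Finset.sup_eq_of_forall_ne hb₀ fun b hb hne =>
      cardIfMax_eq_zero_of_notMem (hnotMem hi b hb hne)]
    exact if_pos ⟨hi, hmax⟩
  have hvalue' : (P.sup fun b => cardIfMax (blockMinus b) i) = b₀.card - 1 := by
    rw [Finset.sup_eq_of_forall_ne hb₀ fun b hb hne =>
      cardIfMax_eq_zero_of_notMem fun h => hnotMem hi b hb hne (mem_blockMinus.1 h).2]
    exact cardIfMax_blockMinus_of_max (hP.zero_notMem hb₀) h1 hi hmax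
  rw [hP.shape_eq_filterMap hk, shape_pminus, hP.sup_sup_blockMinus hk, Nat.sub_add_cancel hk]
  apply step_filterMap_range hik
  · refine fun m hm => Finset.sup_congr rfl fun b hb => ?_
    by_cases hbb : b = b₀
    · subst hbb
      rw [cardIfMax_eq_zero_of_ne hi hmax (by omega),
        cardIfMax_blockMinus_eq_zero_of_ne hi hmax hm]
    · exact cardIfMax_blockMinus (hP.zero_notMem hb) (hnotMem h1 b hb hbb) m
  · rw [hvalue, hvalue']
    omega
  · rw [hvalue']
    intro hc
    have := Finset.card_le_one.1 (by omega : b₀.card ≤ 1) _ hi _ h1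
    omega
end

section
/- For every composition Λ = (Λ_1, …, Λ_l) of k, the number of chains of length k from the empty composition () to Λ (i.e. sequences () = λ^0 → λ^1 → ⋯ → λ^k = Λ of compositions with λ^i → λ^{i+1} for all 0 ≤ i < k) equals k! / ∏_{j=1}^{l} [ (Λ_j − 1)! · |Λ|_j ], where |Λ|_j = Λ_1 + ⋯ + Λ_j. -/
/-- The number of set partitions whose normally ordered shape is `r.reverse`. -/
def shapeCount : List ℕ → ℕ
  | [] => 1
  | a :: r => (r.sum + (a - 1)).choose (a - 1) * shapeCount r

/-- The chains `() = λ⁰ → ⋯ → λᵏ = Lam`. -/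
abbrev Chains (k : ℕ) (Lam : List ℕ) : Type :=
  {c : Fin (k + 1) → List ℕ //
    c 0 = [] ∧ c (Fin.last k) = Lam ∧ ∀ i : Fin k, Step (c i.castSucc) (c i.succ)}

/-- `Step` read on reversed lists. -/
def RevStep (q r : List ℕ) : Prop := Step q.reverse r.reverse

theorem step_iff {q r : List ℕ} :
    Step q r ↔ r = 1 :: q ∨ ∃ p x s, q = p ++ x :: s ∧ r = p ++ (x + 1) :: s := by
  refine or_congr Iff.rfl ⟨?_, ?_⟩
  · rintro ⟨⟨j, hj⟩, rfl⟩
    refine ⟨q.take j, q[j], q.drop (j + 1), by simp, ?_⟩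
    simp [List.set_eq_take_append_cons_drop, hj]
  · rintro ⟨p, x, s, rfl, rfl⟩
    exact ⟨⟨p.length, by simp⟩, by simp⟩

theorem revStep_iff {q r : List ℕ} :
    RevStep q r ↔ r = q ++ [1] ∨ ∃ p x s, q = p ++ x :: s ∧ r = p ++ (x + 1) :: s := by
  rw [RevStep, step_iff]
  refine or_congr ⟨fun h => ?_, fun h => by simp [h]⟩ ⟨?_, ?_⟩
  · simpa using congrArg List.reverse h
  · rintro ⟨p, x, s, h1, h2⟩
    refine ⟨s.reverse, x, p.reverse, ?_, ?_⟩
    · simpa using congrArg List.reverse h1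
    · simpa using congrArg List.reverse h2
  · rintro ⟨p, x, s, rfl, rfl⟩
    exact ⟨s.reverse, x, p.reverse, by simp, by simp⟩

theorem revStep_cons {q r : List ℕ} {a : ℕ} :
    RevStep q (a :: r) ↔ (r = [] ∧ a = 1 ∧ q = []) ∨ (∃ b, a = b + 1 ∧ q = b :: r) ∨
      ∃ q', q = a :: q' ∧ RevStep q' r := by
  simp only [revStep_iff]
  constructor
  · rintro (h | ⟨p, x, s, rfl, h⟩)
    · cases q with
      | nil => simp_all
      | cons b q => simp_all
    · cases p with
      | nil => simp_all
      | cons b p =>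
        simp only [List.cons_append, List.cons.injEq] at h
        obtain ⟨rfl, rfl⟩ := h
        exact Or.inr (Or.inr ⟨_, rfl, Or.inr ⟨p, x, s, rfl, rfl⟩⟩)
  · rintro (⟨rfl, rfl, rfl⟩ | ⟨b, rfl, rfl⟩ | ⟨q', rfl, rfl | ⟨p, x, s, rfl, rfl⟩⟩)
    · simp
    · exact Or.inr ⟨[], b, r, rfl, rfl⟩
    · simp
    · exact Or.inr ⟨a :: p, x, s, rfl, rfl⟩

theorem not_revStep_nil {q : List ℕ} : ¬ RevStep q [] := by
  simp [revStep_iff]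

theorem Step.sum_eq {q r : List ℕ} (h : Step q r) : r.sum = q.sum + 1 := by
  obtain rfl | ⟨p, x, s, rfl, rfl⟩ := step_iff.1 h <;> simp <;> ring

theorem Step.pos {q r : List ℕ} (h : Step q r) (hq : ∀ x ∈ q, 0 < x) : ∀ x ∈ r, 0 < x := by
  obtain rfl | ⟨p, x, s, rfl, rfl⟩ := step_iff.1 h
  · simpa using hq
  · simp only [List.mem_append, List.mem_cons] at hq ⊢
    rintro y (hy | rfl | hy)
    · exact hq _ (Or.inl hy)
    · omega
    · exact hq _ (Or.inr (Or.inr hy))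

theorem Chains.pos {k : ℕ} {Lam : List ℕ} (c : Chains k Lam) : ∀ x ∈ Lam, 0 < x := by
  obtain ⟨c, h0, hl, hs⟩ := c
  have key : ∀ i, ∀ x ∈ c i, 0 < x := by
    intro i
    induction i using Fin.induction with
    | zero => simp [h0]
    | succ i ih => exact (hs i).pos ih
  exact hl ▸ key _

theorem exists_pred_finset (r : List ℕ) (hr : ∀ x ∈ r, 0 < x) (hne : r ≠ []) :
    ∃ T : Finset (List ℕ), (∀ q, q ∈ T ↔ (∀ x ∈ q, 0 < x) ∧ RevStep q r) ∧
      ∑ q ∈ T, shapeCount q = shapeCount r := by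
  induction r with
  | nil => exact absurd rfl hne
  | cons a r ih =>
    simp only [List.mem_cons, forall_eq_or_imp] at hr
    obtain ⟨ha, hr⟩ := hr
    obtain ⟨a, rfl⟩ := Nat.exists_eq_add_of_lt ha
    rw [zero_add]
    rcases eq_or_ne r [] with rfl | hrne
    · cases a with
      | zero =>
        refine ⟨{[]}, fun q => ?_, by simp [shapeCount]⟩
        simp only [Finset.mem_singleton, revStep_cons, not_revStep_nil]
        constructor
        · rintro rfl; simp
        · rintro ⟨hq, h | ⟨b, hb, rfl⟩ | h⟩
          · exact h.2.2
          · simp at hq; omega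
          · simp at h
      | succ a =>
        refine ⟨{[a + 1]}, fun q => ?_, by simp [shapeCount]⟩
        simp only [Finset.mem_singleton, revStep_cons, not_revStep_nil]
        constructor
        · rintro rfl; simp
        · rintro ⟨hq, h | ⟨b, hb, rfl⟩ | h⟩
          · omega
          · simp; omega
          · simp at h
    · obtain ⟨T, hT, hsum⟩ := ih hr hrne
      have hrsum : 0 < r.sum := by
        obtain ⟨x, hx⟩ := List.exists_mem_of_ne_nil r hrne
        exact (hr x hx).trans_le (List.le_sum_of_mem hx)
      have hinj : Function.Injective (List.cons (a + 1)) := List.cons_injective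
      have hTsum : ∑ q ∈ T.map ⟨_, hinj⟩, shapeCount q
          = (r.sum + a - 1).choose a * shapeCount r := by
        rw [Finset.sum_map, ← hsum, Finset.mul_sum]
        refine Finset.sum_congr rfl fun q hq => ?_
        have h := ((hT q).1 hq).2.sum_eq
        simp only [List.sum_reverse] at h
        simp only [Function.Embedding.coeFn_mk, shapeCount, h]
        congr 2
        omega
      cases a with
      | zero =>
        refine ⟨T.map ⟨_, hinj⟩, fun q => ?_, by simp [hTsum, shapeCount]⟩
        simp only [Finset.mem_map, Function.Embedding.coeFn_mk, revStep_cons, hT]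
        constructor
        · rintro ⟨q, ⟨h1, h2⟩, rfl⟩
          exact ⟨by simpa using h1, Or.inr (Or.inr ⟨q, rfl, h2⟩)⟩
        · rintro ⟨hq, h | ⟨b, hb, rfl⟩ | ⟨q, rfl, h⟩⟩
          · exact absurd h.1 hrne
          · simp at hq; omega
          · exact ⟨q, ⟨by simpa using hq, h⟩, rfl⟩
      | succ a =>
        refine ⟨insert ((a + 1) :: r) (T.map ⟨_, hinj⟩), fun q => ?_, ?_⟩
        · simp only [Finset.mem_insert, Finset.mem_map, Function.Embedding.coeFn_mk,
            revStep_cons, hT]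
          constructor
          · rintro (rfl | ⟨q, ⟨h1, h2⟩, rfl⟩)
            · exact ⟨by simpa using hr, Or.inr (Or.inl ⟨_, rfl, rfl⟩)⟩
            · exact ⟨by simpa using h1, Or.inr (Or.inr ⟨q, rfl, h2⟩)⟩
          · rintro ⟨hq, h | ⟨b, hb, rfl⟩ | ⟨q, rfl, h⟩⟩
            · exact absurd h.1 hrne
            · left; congr 1; omega
            · exact Or.inr ⟨q, ⟨fun x hx => hq x (by simp [hx]), h⟩, rfl⟩
        · rw [Finset.sum_insert (by simp), hTsum]
          simp only [shapeCount, Nat.add_sub_cancel, ← add_assoc]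
          rw [Nat.choose_succ_succ, add_mul]

theorem Chains.sigma_ext {k : ℕ} {T : Finset (List ℕ)} {p p' : Σ q : T, Chains k q}
    (h : p.2.1 = p'.2.1) : p = p' := by
  obtain ⟨⟨q, hq⟩, ⟨c, h0, hl, hs⟩⟩ := p
  obtain ⟨⟨q', hq'⟩, ⟨c', h0', hl', hs'⟩⟩ := p'
  dsimp only at h hl hl'
  subst h hl hl'
  rfl

/-- Truncating a chain at its penultimate term. -/
def chainsSuccEquiv {k : ℕ} {Lam : List ℕ} (T : Finset (List ℕ))
    (hT : ∀ q, q ∈ T ↔ (∀ x ∈ q, 0 < x) ∧ Step q Lam) :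
    Chains (k + 1) Lam ≃ Σ q : T, Chains k q where
  toFun c :=
    have c' : Chains k (c.1 (Fin.last k).castSucc) :=
      ⟨fun i => c.1 i.castSucc, c.2.1, rfl, fun i => c.2.2.2 i.castSucc⟩
    ⟨⟨c.1 (Fin.last k).castSucc, (hT _).2 ⟨c'.pos, by
        have h := c.2.2.2 (Fin.last k)
        rwa [Fin.succ_last, c.2.2.1] at h⟩⟩,
      ⟨fun i => c.1 i.castSucc, c.2.1, rfl, fun i => c.2.2.2 i.castSucc⟩⟩
  invFun p := ⟨Fin.snoc (α := fun _ => List ℕ) p.2.1 Lam, by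
      have h := Fin.snoc_castSucc (α := fun _ => List ℕ) Lam p.2.1 0
      rw [Fin.castSucc_zero] at h
      rw [h, p.2.2.1], Fin.snoc_last .., by
      intro i
      induction i using Fin.lastCases with
      | last =>
        rw [Fin.succ_last, Fin.snoc_last, Fin.snoc_castSucc, p.2.2.2.1]
        exact ((hT _).1 p.1.2).2
      | cast i =>
        rw [Fin.succ_castSucc, Fin.snoc_castSucc, Fin.snoc_castSucc]
        exact p.2.2.2.2 i⟩
  left_inv c := by
    apply Subtype.ext
    funext i
    induction i using Fin.lastCases with
    | last => simp [c.2.2.1]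
    | cast i => simp
  right_inv := by
    intro p
    apply Chains.sigma_ext
    funext i
    simp

theorem shapeCount_pos (r : List ℕ) : 0 < shapeCount r := by
  induction r with
  | nil => simp [shapeCount]
  | cons a r ih => exact Nat.mul_pos (Nat.choose_pos (by omega)) ih

theorem card_chains_eq_shapeCount (k : ℕ) (Lam : List ℕ)
    (hpos : ∀ x ∈ Lam, 0 < x) (hsum : Lam.sum = k) :
    Nat.card (Chains k Lam) = shapeCount Lam.reverse := by
  induction k generalizing Lam with
  | zero =>
    obtain rfl : Lam = [] := by
      refine List.eq_nil_iff_forall_not_mem.2 fun x hx => ?_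
      have := List.le_sum_of_mem hx
      have := hpos x hx
      omega
    rw [Nat.card_eq_one_iff_unique.2, List.reverse_nil, shapeCount]
    refine ⟨⟨fun c d => ?_⟩, ⟨⟨fun _ => [], rfl, rfl, fun i => i.elim0⟩⟩⟩
    apply Subtype.ext
    funext i
    rw [Fin.eq_zero i, c.2.1, d.2.1]
  | succ k ih =>
    obtain ⟨T, hT, hTsum⟩ := exists_pred_finset Lam.reverse (by simpa using hpos)
      (by rintro h; simp_all)
    have hT' : ∀ q, q ∈ T.map ⟨_, List.reverse_injective⟩ ↔ (∀ x ∈ q, 0 < x) ∧ Step q Lam := by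
      intro q
      simp only [Finset.mem_map, Function.Embedding.coeFn_mk, hT, RevStep, List.reverse_reverse]
      constructor
      · rintro ⟨q, ⟨h1, h2⟩, rfl⟩
        exact ⟨by simpa using h1, h2⟩
      · rintro ⟨h1, h2⟩
        exact ⟨q.reverse, ⟨by simpa using h1, by simpa using h2⟩, by simp⟩
    have hcard : ∀ q : T.map ⟨_, List.reverse_injective⟩,
        Nat.card (Chains k q) = shapeCount q.1.reverse := by
      intro q
      have hq := (hT' _).1 q.2
      have := hq.2.sum_eq
      exact ih _ hq.1 (by omega)
    have : ∀ q : T.map ⟨_, List.reverse_injective⟩, Finite (Chains k q) := fun q =>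
      Nat.finite_of_card_ne_zero (by rw [hcard]; exact (shapeCount_pos _).ne')
    rw [Nat.card_congr (chainsSuccEquiv _ hT'), Nat.card_sigma,
      Finset.sum_congr rfl fun q _ => hcard q,
      Finset.sum_coe_sort (T.map _) fun q : List ℕ => shapeCount q.reverse, Finset.sum_map, ← hTsum]
    simp

theorem shapeCount_reverse_mul_prod (Lam : List ℕ) (hpos : ∀ x ∈ Lam, 0 < x) :
    shapeCount Lam.reverse * ∏ j ∈ Finset.range Lam.length,
      ((Lam.getD j 0 - 1).factorial * (Lam.take (j + 1)).sum) = Lam.sum.factorial := by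
  induction Lam using List.reverseRecOn with
  | nil => simp [shapeCount]
  | append_singleton L a ih =>
    have ha : 0 < a := hpos a (by simp)
    obtain ⟨a, rfl⟩ := Nat.exists_eq_add_of_lt ha
    have ih := ih fun x hx => hpos x (by simp [hx])
    rw [List.length_append, List.length_singleton, Finset.prod_range_succ,
      Finset.prod_congr rfl (g := fun j => (L.getD j 0 - 1).factorial * (L.take (j + 1)).sum)]
    · have hlast : (L ++ [0 + a + 1]).getD L.length 0 = a + 1 := by simp
      have htake : (L ++ [0 + a + 1]).take (L.length + 1) = L ++ [a + 1] := by
        rw [List.take_of_length_le] <;> simp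
      rw [hlast, htake]
      simp only [List.reverse_append, List.reverse_singleton, List.singleton_append, shapeCount,
        List.sum_reverse, List.sum_append, List.sum_singleton, zero_add, Nat.add_sub_cancel]
      rw [← add_assoc, Nat.factorial_succ, ← Nat.add_choose_mul_factorial_mul_factorial, ← ih]
      ring
    · intro j hj
      rw [Finset.mem_range] at hj
      rw [List.getD_append _ _ _ _ hj, List.take_append_of_le_length hj]

/-- For every composition `Λ = (Λ_1, …, Λ_l)` of `k`, the number of chains
`() = λ⁰ → λ¹ → ⋯ → λᵏ = Λ` equals `k! / ∏_{j=1}^l [(Λ_j − 1)! · |Λ|_j]`,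
where `|Λ|_j = Λ_1 + ⋯ + Λ_j`. -/
theorem card_chains_formula (k : ℕ) (Lam : List ℕ)
    (hpos : ∀ x ∈ Lam, 0 < x) (hsum : Lam.sum = k) :
    Nat.card {c : Fin (k + 1) → List ℕ //
        c 0 = [] ∧ c (Fin.last k) = Lam ∧
          ∀ i : Fin k, Step (c i.castSucc) (c i.succ)}
      = k.factorial /
          ∏ j : Fin Lam.length, ((Lam.get j - 1).factorial * (Lam.take (j.1 + 1)).sum) := by
  have hprod : ∏ j : Fin Lam.length, ((Lam.get j - 1).factorial * (Lam.take (j.1 + 1)).sum)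
      = ∏ j ∈ Finset.range Lam.length,
        ((Lam.getD j 0 - 1).factorial * (Lam.take (j + 1)).sum) := by
    simp [Finset.prod_range]
  have h := shapeCount_reverse_mul_prod Lam hpos
  rw [card_chains_eq_shapeCount k Lam hpos hsum, hprod, ← hsum, ← h]
  refine (Nat.mul_div_cancel _ (Nat.pos_of_ne_zero fun h0 => ?_)).symm
  rw [h0, mul_zero] at h
  exact Lam.sum.factorial_ne_zero h.symm
end

section
/- For every integer k ≥ 0 and every strictly decreasing forest F ∈ Forests_{k∘}, the exponent vector P(F) = (p_1, …, p_k) of F is a Dyck vector of length k, i.e. p_1 + ⋯ + p_j ≤ j for all j ∈ {1,…,k}. -/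
/-- A strictly decreasing (rooted labeled) forest on `Fin n`:
a partially defined father function such that each node's father is strictly
larger.  `f i = none` means `i` is a root. -/
def IsForest {n : ℕ} (f : Fin n → Option (Fin n)) : Prop :=
  ∀ i m, f i = some m → i < m

/-- Number of children of the node `m` in the forest `f`. -/
def nchild {n : ℕ} (f : Fin n → Option (Fin n)) (m : Fin n) : ℕ :=
  (Finset.univ.filter fun i => f i = some m).card

/-- Number of roots (trees) `l_F` of the forest `f`. -/
def nroots {n : ℕ} (f : Fin n → Option (Fin n)) : ℕ :=
  (Finset.univ.filter fun i => f i = none).card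

/-- The exponent vector of a forest on `[k] ∪ {∘}`.  Nodes are `Fin (k+1)`:
index `j < k` is the label `j+1`, and the last index is `∘` (the largest
element).  The entry `p_{j+1}` is `nchild j + 1` if `j` is a root, and
`nchild j` otherwise. -/
def pvec {k : ℕ} (f : Fin (k + 1) → Option (Fin (k + 1))) (j : Fin k) : ℕ :=
  nchild f j.castSucc + (if f j.castSucc = none then 1 else 0)

/-- A Dyck vector of length `k`: `p_1 + ⋯ + p_j ≤ j` for all `j ∈ {1,…,k}`. -/
def DyckVec {k : ℕ} (P : Fin k → ℕ) : Prop :=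
  ∀ j : Fin k, ∑ r ∈ Finset.univ.filter (· ≤ j), P r ≤ j.1 + 1

/-- `D_{P,j} = j − (p_1 + ⋯ + p_j)`. -/
def Dsum {k : ℕ} (P : Fin k → ℕ) (j : ℕ) : ℕ :=
  j - ∑ r ∈ Finset.univ.filter (fun r : Fin k => r.1 < j), P r

/-- The coefficient `C_P = ∏_{j=1}^k [2·binom(D_{P,j−1}, p_j − 1) + binom(D_{P,j−1}, p_j)]`,
with the convention `binom(m, −1) = 0` (handled by the `if`). -/
def CP {k : ℕ} (P : Fin k → ℕ) : ℕ :=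
  ∏ j : Fin k,
    (2 * (if P j = 0 then 0 else (Dsum P j.1).choose (P j - 1))
      + (Dsum P j.1).choose (P j))

/-- The pruned-and-grafted forest `F'` of a forest `F` on `[k+1] ∪ {∘}`:
detach all children of `∘` and attach them to the node `k+1`, then relabel
`k+1` as `∘`.  (Index `k` of `Fin (k+2)` is the label `k+1`; it becomes the
index `k`, i.e. the `∘`, of `Fin (k+1)`.) -/
def prune {k : ℕ} (f : Fin (k + 2) → Option (Fin (k + 2))) :
    Fin (k + 1) → Option (Fin (k + 1)) :=
  fun i =>
    if i.1 = k then none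
    else (f i.castSucc).map fun m => ⟨min m.1 k, by omega⟩


/-- The entry of the exponent vector at `r` counts the nodes sent to `r` by the total map which
sends a node to its father, and a root to itself. -/
theorem pvec_eq_card {k : ℕ} (f : Fin (k + 1) → Option (Fin (k + 1))) (r : Fin k) :
    pvec f r = (Finset.univ.filter fun i => (f i).getD i = r.castSucc).card := by
  have h_split : (Finset.univ.filter fun i => (f i).getD i = r.castSucc) =
      (Finset.univ.filter fun i => f i = some r.castSucc) ∪
        (Finset.univ.filter fun i => i = r.castSucc ∧ f r.castSucc = none) := by
    ext i
    cases h : f i <;> simp <;> grind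
  have h_disj : Disjoint (Finset.univ.filter fun i => f i = some r.castSucc)
      (Finset.univ.filter fun i => i = r.castSucc ∧ f r.castSucc = none) := by
    rw [Finset.disjoint_filter]
    grind
  rw [h_split, Finset.card_union_of_disjoint h_disj, pvec, nchild]
  split_ifs with h <;> simp [Finset.filter_eq', h]

/-- The exponent vector of any strictly decreasing forest on `[k] ∪ {∘}` is a
Dyck vector of length `k`. -/
theorem pvec_isDyck (k : ℕ) (f : Fin (k + 1) → Option (Fin (k + 1)))
    (hf : IsForest f) :
    DyckVec (pvec f) := by
  intro j
  simp_rw [pvec_eq_card]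
  rw [← Finset.card_biUnion]
  · calc
      _ ≤ (Finset.Iic j.castSucc).card := by
        refine Finset.card_le_card fun i hi => ?_
        simp only [Finset.mem_biUnion, Finset.mem_filter, Finset.mem_univ, true_and] at hi
        obtain ⟨r, hr, hi⟩ := hi
        have h_le : i ≤ r.castSucc := by
          cases h : f i with
          | none => simp_all
          | some m => simpa [h, ← hi] using (hf i m h).le
        exact Finset.mem_Iic.2 (h_le.trans hr)
      _ = j.1 + 1 := by simp
  · intro r _ s _ hrs
    refine Finset.disjoint_filter.2 ?_
    intro i _ hr hs
    exact hrs (Fin.castSucc_injective k (hr.symm.trans hs))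
end

section
/- For every integer k ≥ 1 and every F ∈ Forests_{k∘} with exponent vector P(F) = (p_1, …, p_k), the exponent vector of the pruned-and-grafted forest F' ∈ Forests_{(k−1)∘} is the truncation (p_1, …, p_{k−1}); equivalently, the monomial X_{F'} equals X_F evaluated at X_k = 1. -/
lemma prune_eq_some_castSucc_iff {k : ℕ} {f : Fin (k + 2) → Option (Fin (k + 2))}
    (hf : IsForest f) (i : Fin (k + 1)) (j : Fin k) :
    prune f i = some j.castSucc ↔ f i.castSucc = some j.castSucc.castSucc := by
  have hj := j.2
  unfold prune
  split_ifs with hi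
  · refine ⟨fun h => by simp at h, fun h => ?_⟩
    have h' : i.1 < j.1 := by simpa [Fin.lt_def] using hf _ _ h
    omega
  · simp only [Option.map_eq_some_iff]
    constructor
    · rintro ⟨m, hm, hmj⟩
      rw [hm]
      have h' : min m.1 k = j.1 := by simpa [Fin.ext_iff] using hmj
      congr 1
      ext
      simp only [Fin.val_castSucc]
      omega
    · intro h
      refine ⟨_, h, ?_⟩
      ext
      simp only [Fin.val_castSucc]
      omega

lemma prune_castSucc_eq_none_iff {k : ℕ} (f : Fin (k + 2) → Option (Fin (k + 2)))
    (j : Fin k) : prune f j.castSucc = none ↔ f j.castSucc.castSucc = none := by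
  have hj : j.1 ≠ k := j.2.ne
  simp [prune, hj]

lemma IsForest.prune {k : ℕ} {f : Fin (k + 2) → Option (Fin (k + 2))}
    (hf : IsForest f) : IsForest (prune f) := by
  intro i m h
  unfold _root_.prune at h
  split_ifs at h with hi
  obtain ⟨a, ha, rfl⟩ := Option.map_eq_some_iff.1 h
  have h' : i.1 < a.1 := by simpa [Fin.lt_def] using hf _ _ ha
  rw [Fin.lt_def]
  have := i.2
  simp only
  omega

lemma nchild_prune {k : ℕ} {f : Fin (k + 2) → Option (Fin (k + 2))}
    (hf : IsForest f) (j : Fin k) :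
    nchild (prune f) j.castSucc = nchild f j.castSucc.castSucc := by
  unfold nchild
  rw [← Finset.card_map Fin.castSuccEmb]
  congr 1
  ext x
  simp only [Finset.mem_map, Finset.mem_filter, Finset.mem_univ, true_and,
    prune_eq_some_castSucc_iff hf, Fin.coe_castSuccEmb]
  constructor
  · rintro ⟨i, hi, rfl⟩
    exact hi
  · intro h
    have hx : x.1 < j.1 := by simpa [Fin.lt_def] using hf _ _ h
    exact ⟨⟨x.1, by omega⟩, h, rfl⟩

/-- For every forest `F ∈ Forests_{(k+1)∘}`, the pruned-and-grafted `F'` is a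
strictly decreasing forest in `Forests_{k∘}` and its exponent vector is the
truncation `(p_1, …, p_k)` of the exponent vector `(p_1, …, p_{k+1})` of `F`;
equivalently `X_{F'} = X_F |_{X_{k+1} = 1}`. -/
theorem pvec_prune (k : ℕ) (f : Fin (k + 2) → Option (Fin (k + 2)))
    (hf : IsForest f) :
    IsForest (prune f) ∧ ∀ i : Fin k, pvec (prune f) i = pvec f i.castSucc := by
  refine ⟨hf.prune, fun i => ?_⟩
  simp only [pvec, nchild_prune hf, prune_castSucc_eq_none_iff]
end

section
/- For every integer k ≥ 0, the identity of polynomials in the variables B, X_1, …, X_k holds: Σ_{F ∈ Forests_{k∘}} 2^{l_F − 1} · B^{nchild_F(∘)} · X_1^{p_1(F)} ⋯ X_k^{p_k(F)} = Σ_{P ∈ Dyck(k)} C_P · B^{D_{P,k}} · X_1^{p_1} ⋯ X_k^{p_k}, where (p_1(F), …, p_k(F)) is the exponent vector of F and C_P = ∏_{j=1}^k [ 2·binom(D_{P,j−1}, p_j − 1) + binom(D_{P,j−1}, p_j) ]. -/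
theorem sum_two_choose_pred_add_choose_mul {R : Type*} [CommSemiring R] (b y : R) (n : ℕ) :
    ∑ p ∈ Finset.range (n + 2),
      ((2 * (if p = 0 then 0 else n.choose (p - 1)) + n.choose p : ℕ) : R) *
        b ^ (n + 1 - p) * y ^ p = (2 * y + b) * (b + y) ^ n := by
  have h₁ : ∑ p ∈ Finset.range (n + 2),
      ((n.choose p : ℕ) : R) * b ^ (n + 1 - p) * y ^ p = b * (b + y) ^ n := by
    rw [Finset.sum_range_succ, Nat.choose_succ_self, add_comm b y, add_pow, Finset.mul_sum]
    simp only [Nat.cast_zero, zero_mul, add_zero]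
    refine Finset.sum_congr rfl fun p hp => ?_
    rw [Nat.succ_sub (Finset.mem_range_succ_iff.mp hp), pow_succ]
    ring
  have h₂ : ∑ p ∈ Finset.range (n + 2),
      ((2 * (if p = 0 then 0 else n.choose (p - 1)) : ℕ) : R) * b ^ (n + 1 - p) * y ^ p =
        2 * y * (b + y) ^ n := by
    rw [Finset.sum_range_succ', add_comm b y, add_pow, Finset.mul_sum]
    simp only [if_true, mul_zero, Nat.cast_zero, zero_mul, add_zero]
    refine Finset.sum_congr rfl fun p _ => ?_
    simp only [Nat.add_sub_add_right, Nat.add_sub_cancel, Nat.succ_ne_zero, if_false]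
    push_cast
    ring
  rw [add_mul, ← h₁, ← h₂, ← Finset.sum_add_distrib]
  refine Finset.sum_congr rfl fun p _ => ?_
  push_cast
  ring

theorem sum_filter_val_lt_snoc {k : ℕ} (P : Fin k → ℕ) (p : ℕ) {j : ℕ} (hj : j ≤ k) :
    ∑ r ∈ Finset.univ.filter (fun r : Fin (k + 1) => r.1 < j),
        (Fin.snoc P p : Fin (k + 1) → ℕ) r =
      ∑ r ∈ Finset.univ.filter (fun r : Fin k => r.1 < j), P r := by
  simp [Finset.sum_filter, Fin.sum_univ_castSucc, Nat.not_lt.mpr hj]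

theorem Dsum_snoc_of_le {k : ℕ} (P : Fin k → ℕ) (p : ℕ) {j : ℕ} (hj : j ≤ k) :
    Dsum (Fin.snoc P p : Fin (k + 1) → ℕ) j = Dsum P j := by
  rw [Dsum, Dsum, sum_filter_val_lt_snoc P p hj]

theorem Dsum_self {k : ℕ} (P : Fin k → ℕ) : Dsum P k = k - ∑ r, P r := by
  simp [Dsum]

theorem CP_snoc {k : ℕ} (P : Fin k → ℕ) (p : ℕ) :
    CP (Fin.snoc P p : Fin (k + 1) → ℕ) =
      CP P * (2 * (if p = 0 then 0 else (Dsum P k).choose (p - 1)) + (Dsum P k).choose p) := by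
  simp [CP, Fin.prod_univ_castSucc, Dsum_snoc_of_le, Fin.is_le']

theorem dyckVec_snoc_iff {k : ℕ} (P : Fin k → ℕ) (p : ℕ) :
    DyckVec (Fin.snoc P p : Fin (k + 1) → ℕ) ↔ DyckVec P ∧ ∑ r, P r + p ≤ k + 1 := by
  simp [DyckVec, Fin.forall_fin_succ', Finset.sum_filter, Fin.sum_univ_castSucc,
    Fin.le_last]

theorem DyckVec.sum_le {k : ℕ} {P : Fin k → ℕ} (h : DyckVec P) : ∑ r, P r ≤ k := by
  cases k with
  | zero => simp
  | succ k => simpa [Finset.filter_true_of_mem, Fin.le_last] using h (Fin.last k)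

open Classical in
/-- The generating function of weighted Dyck vectors factors into linear forms.
Entries are bounded by an arbitrary `N > k`. -/
theorem sum_dyckVec_eq_prod {R : Type*} [CommSemiring R] (N k : ℕ) (hk : k < N) (b : R)
    (x : Fin k → R) :
    ∑ P ∈ Finset.univ.filter (fun P : Fin k → Fin N => DyckVec fun j => (P j).1),
      ((CP fun j => (P j).1 : ℕ) : R) * b ^ (Dsum (fun j => (P j).1) k) *
        ∏ j : Fin k, x j ^ (P j).1 =
      ∏ j : Fin k, (2 * x j + (b + ∑ m, if j < m then x m else 0)) := by
  induction k generalizing b with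
  | zero => simp [DyckVec, CP, Dsum]
  | succ k ih =>
    have hlin : ∏ j : Fin (k + 1), (2 * x j + (b + ∑ m, if j < m then x m else 0)) =
        (∏ j : Fin k, (2 * x j.castSucc + ((b + x (Fin.last k)) +
          ∑ m : Fin k, if j < m then x m.castSucc else 0))) * (2 * x (Fin.last k) + b) := by
      rw [Fin.prod_univ_castSucc]
      congr 1
      · refine Finset.prod_congr rfl fun j _ => ?_
        rw [Fin.sum_univ_castSucc]
        simp only [Fin.castSucc_lt_castSucc_iff, Fin.castSucc_lt_last, if_true]
        ring
      · simp [Fin.not_lt.mpr (Fin.le_last _)]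
    rw [hlin, ← ih (by omega) (b + x (Fin.last k)) (fun j => x j.castSucc), Finset.sum_mul,
      Finset.sum_filter, ← (Fin.snocEquiv fun _ => Fin N).sum_comp, Fintype.sum_prod_type_right,
      Finset.sum_filter]
    refine Finset.sum_congr rfl fun Q _ => ?_
    have hsnoc (p : Fin N) : (fun j => ((Fin.snocEquiv (fun _ => Fin N) (p, Q)) j).1) =
        (Fin.snoc (fun j => (Q j).1) p.1 : Fin (k + 1) → ℕ) := by
      funext j
      refine Fin.lastCases ?_ (fun i => ?_) j <;> simp [Fin.snocEquiv]
    have hprod (p : Fin N) :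
        ∏ j, x j ^ ((Fin.snocEquiv (fun _ => Fin N) (p, Q)) j).1 =
          (∏ j : Fin k, x j.castSucc ^ (Q j).1) * x (Fin.last k) ^ p.1 := by
      rw [Fin.prod_univ_castSucc]
      simp [Fin.snocEquiv]
    simp only [hsnoc, hprod, dyckVec_snoc_iff, CP_snoc, Dsum_self (Fin.snoc _ _),
      Fin.sum_snoc]
    generalize hq : (fun j => (Q j).1) = q
    by_cases hQ : DyckVec q
    · have hle := hQ.sum_le
      have hn : Dsum q k = k - ∑ r, q r := Dsum_self q
      simp only [hQ, true_and, if_true]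
      set n := Dsum q k
      rw [Fin.sum_univ_eq_sum_range (fun p => if ∑ r, q r + p ≤ k + 1 then
        ((CP q * (2 * (if p = 0 then 0 else n.choose (p - 1)) + n.choose p) : ℕ) : R) *
          b ^ (k + 1 - (∑ r, q r + p)) *
          ((∏ j : Fin k, x j.castSucc ^ (Q j).1) * x (Fin.last k) ^ p) else 0) N,
        ← Finset.sum_filter]
      have hrange : (Finset.range N).filter (fun p => ∑ r, q r + p ≤ k + 1) =
          Finset.range (n + 2) := by
        ext p
        simp only [Finset.mem_filter, Finset.mem_range]
        omega
      rw [hrange]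
      calc _ = ∑ p ∈ Finset.range (n + 2), (CP q : R) * (∏ j : Fin k, x j.castSucc ^ (Q j).1) *
            (((2 * (if p = 0 then 0 else n.choose (p - 1)) + n.choose p : ℕ) : R) *
              b ^ (n + 1 - p) * x (Fin.last k) ^ p) := by
            refine Finset.sum_congr rfl fun p _ => ?_
            rw [show k + 1 - (∑ r, q r + p) = n + 1 - p by omega, Nat.cast_mul]
            ring
        _ = _ := by
            rw [← Finset.mul_sum, sum_two_choose_pred_add_choose_mul]
            ring
    · simp [hQ]

theorem IsForest.apply_last {k : ℕ} {f : Fin (k + 1) → Option (Fin (k + 1))}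
    (hf : IsForest f) : f (Fin.last k) = none := by
  rw [Option.eq_none_iff_forall_ne_some]
  exact fun m hm => absurd (hf _ m hm) (Fin.not_lt.mpr (Fin.le_last m))

theorem prod_elim_eq_prod_pow_nchild {R : Type*} [CommMonoid R] {n : ℕ}
    (f : Fin n → Option (Fin n)) (z : Fin n → R) :
    ∏ i, (f i).elim 1 z = ∏ m, z m ^ nchild f m := by
  have h (m : Fin n) : z m ^ nchild f m = ∏ i, if f i = some m then z m else 1 := by
    rw [nchild, Finset.prod_ite, Finset.prod_const, Finset.prod_const_one, mul_one]
  simp only [h]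
  rw [Finset.prod_comm]
  refine Finset.prod_congr rfl fun i _ => ?_
  cases f i <;> simp

theorem IsForest.nroots_sub_one {k : ℕ} {f : Fin (k + 1) → Option (Fin (k + 1))}
    (hf : IsForest f) :
    nroots f - 1 = (Finset.univ.filter fun j : Fin k => f j.castSucc = none).card := by
  simp only [nroots, Finset.card_filter, Fin.sum_univ_castSucc, hf.apply_last, if_true,
    Nat.add_sub_cancel]

theorem IsForest.weight_eq_prod {R : Type*} [CommSemiring R] {k : ℕ}
    {f : Fin (k + 1) → Option (Fin (k + 1))} (hf : IsForest f) (b : R) (x : Fin k → R) :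
    ((2 ^ (nroots f - 1) : ℕ) : R) * b ^ nchild f (Fin.last k) * ∏ j : Fin k, x j ^ pvec f j =
      ∏ i, (f i).elim ((Fin.snoc (fun j => 2 * x j) 1 : Fin (k + 1) → R) i)
        (Fin.snoc x b : Fin (k + 1) → R) := by
  have hroots : ((2 ^ (nroots f - 1) : ℕ) : R) =
      ∏ j : Fin k, if f j.castSucc = none then 2 else 1 := by
    rw [hf.nroots_sub_one, Finset.prod_ite, Finset.prod_const, Finset.prod_const_one, mul_one]
    push_cast
    rfl
  have hsplit (i : Fin (k + 1)) : (f i).elim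
      ((Fin.snoc (fun j => 2 * x j) 1 : Fin (k + 1) → R) i) (Fin.snoc x b : Fin (k + 1) → R) =
      (if f i = none then (Fin.snoc (fun j => 2 * x j) 1 : Fin (k + 1) → R) i else 1) *
        (f i).elim 1 (Fin.snoc x b : Fin (k + 1) → R) := by
    cases f i <;> simp
  simp only [hsplit]
  rw [Finset.prod_mul_distrib, prod_elim_eq_prod_pow_nchild, Fin.prod_univ_castSucc,
    Fin.prod_univ_castSucc, hroots]
  have hx (j : Fin k) : x j ^ pvec f j =
      (if f j.castSucc = none then x j else 1) * x j ^ nchild f j.castSucc := by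
    rw [pvec]
    split_ifs <;> simp [pow_succ, mul_comm]
  have htwo (j : Fin k) : (if f j.castSucc = none then 2 * x j else 1) =
      (if f j.castSucc = none then 2 else 1) * (if f j.castSucc = none then x j else 1) := by
    split_ifs <;> simp
  simp only [hx, Fin.snoc_castSucc, Fin.snoc_last, hf.apply_last, if_true, mul_one, htwo,
    Finset.prod_mul_distrib]
  ring

open Classical in
/-- The generating function of weighted decreasing forests factors into linear forms, the factor
of a node recording the choice of its father. -/
theorem sum_isForest_eq_prod {R : Type*} [CommSemiring R] (k : ℕ) (b : R) (x : Fin k → R) :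
    ∑ f ∈ Finset.univ.filter (fun f : Fin (k + 1) → Option (Fin (k + 1)) => IsForest f),
      ((2 ^ (nroots f - 1) : ℕ) : R) * b ^ nchild f (Fin.last k) *
        ∏ j : Fin k, x j ^ pvec f j =
      ∏ j : Fin k, (2 * x j + (b + ∑ m, if j < m then x m else 0)) := by
  have hpi : (Finset.univ.filter fun f : Fin (k + 1) → Option (Fin (k + 1)) => IsForest f) =
      Fintype.piFinset fun i => Finset.univ.filter fun o : Option (Fin (k + 1)) =>
        ∀ m, o = some m → i < m := by
    ext f
    simp only [Finset.mem_filter, Fintype.mem_piFinset, Finset.mem_univ, true_and]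
    rfl
  calc _ = ∑ f ∈ Finset.univ.filter
          (fun f : Fin (k + 1) → Option (Fin (k + 1)) => IsForest f),
        ∏ i, (f i).elim ((Fin.snoc (fun j => 2 * x j) 1 : Fin (k + 1) → R) i)
          (Fin.snoc x b : Fin (k + 1) → R) :=
        Finset.sum_congr rfl fun f hf => (Finset.mem_filter.mp hf).2.weight_eq_prod b x
    _ = _ := by
        rw [hpi, ← Finset.prod_univ_sum _ fun i (o : Option (Fin (k + 1))) =>
          o.elim ((Fin.snoc (fun j => 2 * x j) 1 : Fin (k + 1) → R) i)
            (Fin.snoc x b : Fin (k + 1) → R)]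
        simp [Finset.sum_filter, Fintype.sum_option, Fin.prod_univ_castSucc,
          Fin.sum_univ_castSucc, Fin.not_lt.mpr (Fin.le_last _), Fin.castSucc_lt_last, add_comm]

open MvPolynomial Classical in
/-- The polynomial identity in the variables `B = X none` and
`X_1, …, X_k = X (some j)`:
`Σ_{F ∈ Forests_{k∘}} 2^{l_F−1} B^{nchild_F(∘)} X^{P(F)}
  = Σ_{P ∈ Dyck(k)} C_P B^{D_{P,k}} X^P`. -/
theorem forest_dyck_polynomial (k : ℕ) :
    ∑ f ∈ Finset.univ.filter
        (fun f : Fin (k + 1) → Option (Fin (k + 1)) => IsForest f),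
      ((2 ^ (nroots f - 1) : ℕ) : MvPolynomial (Option (Fin k)) ℕ) *
        (X none) ^ (nchild f (Fin.last k)) *
        ∏ j : Fin k, (X (some j)) ^ (pvec f j)
    = ∑ P ∈ Finset.univ.filter
        (fun P : Fin k → Fin (k + 1) => DyckVec fun j => (P j).1),
      ((CP fun j => (P j).1 : ℕ) : MvPolynomial (Option (Fin k)) ℕ) *
        (X none) ^ (Dsum (fun j => (P j).1) k) *
        ∏ j : Fin k, (X (some j)) ^ (P j).1 := by
  rw [sum_isForest_eq_prod k (X none) fun j => X (some j),
    ← sum_dyckVec_eq_prod (k + 1) k k.lt_succ_self (X none) fun j => X (some j)]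
end
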